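/- Let c(n) denote the total number of square-lattice walks of length n that start at (0,0) and are confined to the three-quadrant cone C (with arbitrary endpoint). Then c(n) is asymptotically equivalent, as n → ∞, to (2^5 · √3 / (3^3 · Γ(2/3))) · 4^n / n^{1/3}, where Γ is the Gamma function. -/

import Mathlib

/-- Square-lattice steps. -/
def squareSteps : Set (ℤ × ℤ) := {(1,0), (-1,0), (0,1), (0,-1)}

/-- Diagonal-lattice steps. -/
def diagSteps : Set (ℤ × ℤ) := {(1,1), (1,-1), (-1,1), (-1,-1)}

/-- The three-quadrant cone `C = {(i,j) : i ≥ 0 or j ≥ 0}`. -/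
def coneC : Set (ℤ × ℤ) := {p | 0 ≤ p.1 ∨ 0 ≤ p.2}

/-- The quadrant `Q = {(i,j) : i ≥ 0 and j ≥ 0}`. -/
def quadQ : Set (ℤ × ℤ) := {p | 0 ≤ p.1 ∧ 0 ≤ p.2}

/-- Number of walks of length `n` with steps in `steps`, from `a` to `b`,
confined to `region`. -/
noncomputable def walkCount (steps region : Set (ℤ × ℤ)) (a b : ℤ × ℤ) (n : ℕ) : ℕ :=
  Nat.card {w : Fin (n+1) → ℤ × ℤ //
    w 0 = a ∧ w (Fin.last n) = b ∧
    (∀ k : Fin n, w k.succ - w k.castSucc ∈ steps) ∧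
    (∀ k, w k ∈ region)}

/-- Number of walks of length `n` with steps in `steps`, starting at `a`,
confined to `region` (arbitrary endpoint). -/
noncomputable def walkCountAll (steps region : Set (ℤ × ℤ)) (a : ℤ × ℤ) (n : ℕ) : ℕ :=
  Nat.card {w : Fin (n+1) → ℤ × ℤ //
    w 0 = a ∧
    (∀ k : Fin n, w k.succ - w k.castSucc ∈ steps) ∧
    (∀ k, w k ∈ region)}

section Tauberian

open Filter Topology MeasureTheory Set

/-- Rescaled Abel means of `a` tested against `ψ`. -/
noncomputable def abelMean (a : ℕ → ℝ) (ρ : ℝ) (ψ : ℝ → ℝ) (N : ℕ) : ℝ :=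
  (N : ℝ) ^ (-ρ) * ∑' n, a n * Real.exp (-1 / N) ^ n * ψ (Real.exp (-1 / N) ^ n)

/-- The Gamma density of parameter `ρ` tested against `u ↦ ψ (exp (-u))`. -/
noncomputable def gammaMean (ρ : ℝ) (ψ : ℝ → ℝ) : ℝ :=
  ∫ u in Ioi (0 : ℝ), u ^ (ρ - 1) * Real.exp (-u) * ψ (Real.exp (-u))

theorem gammaMean_integrable {ρ : ℝ} (hρ : 0 < ρ) {ψ : ℝ → ℝ} (hψ : ContinuousOn ψ (Icc 0 1)) :
    IntegrableOn (fun u => u ^ (ρ - 1) * Real.exp (-u) * ψ (Real.exp (-u))) (Ioi (0 : ℝ)) := by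
  obtain ⟨M, hM⟩ := isCompact_Icc.exists_bound_of_continuousOn hψ
  have h0 : IntegrableOn (fun u => u ^ (ρ - 1) * Real.exp (-u)) (Ioi (0 : ℝ)) := by
    simpa only [mul_comm] using Real.GammaIntegral_convergent hρ
  refine Integrable.mul_bdd (c := M) h0 ?_ ?_
  · refine ContinuousOn.aestronglyMeasurable ?_ measurableSet_Ioi
    refine hψ.comp (by fun_prop) fun u hu => ⟨(Real.exp_pos _).le, ?_⟩
    simpa using (mem_Ioi.mp hu).le
  · filter_upwards [ae_restrict_mem measurableSet_Ioi] with u hu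
    exact hM _ ⟨(Real.exp_pos _).le, by simpa using (mem_Ioi.mp hu).le⟩

theorem exp_neg_inv_mem {N : ℕ} (hN : 0 < N) : Real.exp (-1 / N) ∈ Ioo (0 : ℝ) 1 :=
  ⟨Real.exp_pos _, by
    rw [Real.exp_lt_one_iff, neg_div, neg_lt_zero]
    have : (0 : ℝ) < N := by exact_mod_cast hN
    positivity⟩

theorem abelMean_summable {a : ℕ → ℝ} (ha0 : ∀ n, 0 ≤ a n)
    (ha : ∀ s ∈ Ioo (0 : ℝ) 1, Summable fun n => a n * s ^ n) {ψ : ℝ → ℝ}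
    (hψ : ContinuousOn ψ (Icc 0 1)) {N : ℕ} (hN : 0 < N) :
    Summable fun n => a n * Real.exp (-1 / N) ^ n * ψ (Real.exp (-1 / N) ^ n) := by
  obtain ⟨M, hM⟩ := isCompact_Icc.exists_bound_of_continuousOn hψ
  have hs := exp_neg_inv_mem hN
  refine Summable.of_norm_bounded ((ha _ hs).mul_right M) fun n => ?_
  have hx : Real.exp (-1 / N) ^ n ∈ Icc (0 : ℝ) 1 :=
    ⟨pow_nonneg hs.1.le _, pow_le_one₀ hs.1.le hs.2.le⟩
  rw [norm_mul, Real.norm_of_nonneg (mul_nonneg (ha0 n) hx.1)]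
  exact mul_le_mul_of_nonneg_left (hM _ hx) (mul_nonneg (ha0 n) hx.1)

theorem tendsto_abelMean_monomial {a : ℕ → ℝ} {ρ K : ℝ} (hρ : 0 < ρ)
    (hK : Tendsto (fun s => (1 - s) ^ ρ * ∑' n, a n * s ^ n) (𝓝[<] 1) (𝓝 K)) (k : ℕ) :
    Tendsto (abelMean a ρ fun x => x ^ k) atTop
      (𝓝 (K / Real.Gamma ρ * gammaMean ρ fun x => x ^ k)) := by
  have hval : K / Real.Gamma ρ * gammaMean ρ (fun x => x ^ k) = K / ((k : ℝ) + 1) ^ ρ := by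
    have h := Real.integral_rpow_mul_exp_neg_mul_Ioi hρ (by positivity : (0 : ℝ) < k + 1)
    have : gammaMean ρ (fun x => x ^ k) = (1 / ((k : ℝ) + 1)) ^ ρ * Real.Gamma ρ := by
      rw [← h, gammaMean]
      refine setIntegral_congr_fun measurableSet_Ioi fun u _ => ?_
      simp only [mul_assoc, ← Real.exp_nat_mul, ← Real.exp_add]
      ring_nf
    have hG := (Real.Gamma_pos_of_pos hρ).ne'
    rw [this, Real.div_rpow (by norm_num) (by positivity), Real.one_rpow]
    field_simp
  rw [hval]
  have hN0 : Tendsto (fun N : ℕ => -((k : ℝ) + 1) / N) atTop (𝓝 0) :=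
    tendsto_const_div_atTop_nhds_zero_nat _
  have hs : Tendsto (fun N : ℕ => Real.exp (-((k : ℝ) + 1) / N)) atTop (𝓝[<] 1) := by
    refine tendsto_nhdsWithin_iff.mpr ⟨?_, ?_⟩
    · have := (Real.continuous_exp.tendsto 0).comp hN0
      rwa [Real.exp_zero] at this
    · filter_upwards [eventually_gt_atTop 0] with N hN
      have : (0 : ℝ) < N := by exact_mod_cast hN
      simp only [mem_Iio, Real.exp_lt_one_iff]
      rw [neg_div, neg_lt_zero]; positivity
  have hd : Tendsto (fun N : ℕ => (N : ℝ) * (1 - Real.exp (-((k : ℝ) + 1) / N))) atTop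
      (𝓝 ((k : ℝ) + 1)) := by
    have h1 : HasDerivAt Real.exp 1 0 := by simpa using Real.hasDerivAt_exp 0
    have h2 := (hasDerivAt_iff_tendsto_slope.mp h1).comp
      (tendsto_nhdsWithin_iff.mpr ⟨hN0, by
        filter_upwards [eventually_gt_atTop 0] with N hN
        have : (0 : ℝ) < N := by exact_mod_cast hN
        simp only [mem_compl_iff, mem_singleton_iff]
        rw [neg_div, neg_eq_zero]; positivity⟩)
    have h3 := h2.const_mul ((k : ℝ) + 1)
    rw [mul_one] at h3
    refine h3.congr' ?_
    filter_upwards [eventually_gt_atTop 0] with N hN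
    have : (0 : ℝ) < N := by exact_mod_cast hN
    have hk : (k : ℝ) + 1 ≠ 0 := by positivity
    simp only [Function.comp, slope_def_field, Real.exp_zero, sub_zero]
    rw [neg_div, div_neg]
    field_simp
    ring
  have hlim := (hK.comp hs).div (hd.rpow_const (p := ρ) (Or.inr hρ.le)) (by positivity)
  refine hlim.congr' ?_
  filter_upwards [eventually_gt_atTop 0] with N hN
  have hNp : (0 : ℝ) < N := by exact_mod_cast hN
  have h1 : 0 < 1 - Real.exp (-((k : ℝ) + 1) / N) := by
    rw [sub_pos, Real.exp_lt_one_iff, neg_div, neg_lt_zero]; positivity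
  simp only [Pi.div_apply, Function.comp, abelMean]
  rw [Real.mul_rpow hNp.le h1.le, Real.rpow_neg hNp.le]
  have e : ∀ n, a n * Real.exp (-1 / N) ^ n * (Real.exp (-1 / N) ^ n) ^ k =
      a n * Real.exp (-((k : ℝ) + 1) / N) ^ n := fun n => by
    rw [mul_assoc, ← pow_mul, ← pow_add, ← Real.exp_nat_mul, ← Real.exp_nat_mul]
    congr 2
    push_cast
    ring
  simp only [e]
  rw [mul_comm ((N : ℝ) ^ ρ), mul_div_mul_left _ _ (Real.rpow_pos_of_pos h1 ρ).ne',
    div_eq_inv_mul]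

theorem tendsto_abelMean_polynomial {a : ℕ → ℝ} {ρ K : ℝ} (hρ : 0 < ρ) (ha0 : ∀ n, 0 ≤ a n)
    (ha : ∀ s ∈ Ioo (0 : ℝ) 1, Summable fun n => a n * s ^ n)
    (hK : Tendsto (fun s => (1 - s) ^ ρ * ∑' n, a n * s ^ n) (𝓝[<] 1) (𝓝 K))
    (p : Polynomial ℝ) :
    Tendsto (abelMean a ρ fun x => p.eval x) atTop
      (𝓝 (K / Real.Gamma ρ * gammaMean ρ fun x => p.eval x)) := by
  induction p using Polynomial.induction_on' with
  | add p q hp hq =>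
    have := hp.add hq
    rw [← mul_add] at this
    have hg : gammaMean ρ (fun x => (p + q).eval x) =
        gammaMean ρ (fun x => p.eval x) + gammaMean ρ (fun x => q.eval x) := by
      simp only [gammaMean]
      rw [← integral_add (gammaMean_integrable hρ p.continuous.continuousOn)
        (gammaMean_integrable hρ q.continuous.continuousOn)]
      simp [mul_add]
    rw [hg]
    refine this.congr' ?_
    filter_upwards [eventually_gt_atTop 0] with N hN
    simp only [abelMean]
    rw [← mul_add, ← (abelMean_summable ha0 ha p.continuous.continuousOn hN).tsum_add
      (abelMean_summable ha0 ha q.continuous.continuousOn hN)]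
    simp [mul_add]
  | monomial k c =>
    have := (tendsto_abelMean_monomial hρ hK k).const_mul c
    have hg : K / Real.Gamma ρ * gammaMean ρ (fun x => (Polynomial.monomial k c).eval x) =
        c * (K / Real.Gamma ρ * gammaMean ρ fun x => x ^ k) := by
      simp only [gammaMean, Polynomial.eval_monomial, mul_left_comm _ c, integral_const_mul]
    rw [hg]
    refine this.congr fun N => ?_
    simp only [abelMean, Polynomial.eval_monomial, mul_left_comm _ c, tsum_mul_left]

theorem tendsto_abelMean {a : ℕ → ℝ} {ρ K : ℝ} (hρ : 0 < ρ) (ha0 : ∀ n, 0 ≤ a n)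
    (ha : ∀ s ∈ Ioo (0 : ℝ) 1, Summable fun n => a n * s ^ n)
    (hK : Tendsto (fun s => (1 - s) ^ ρ * ∑' n, a n * s ^ n) (𝓝[<] 1) (𝓝 K))
    {ψ : ℝ → ℝ} (hψ : ContinuousOn ψ (Icc 0 1)) :
    Tendsto (abelMean a ρ ψ) atTop (𝓝 (K / Real.Gamma ρ * gammaMean ρ ψ)) := by
  have h1 : Tendsto (abelMean a ρ fun _ => 1) atTop
      (𝓝 (K / Real.Gamma ρ * gammaMean ρ fun _ => 1)) := by
    simpa using tendsto_abelMean_monomial hρ hK 0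
  set B := |K / Real.Gamma ρ * gammaMean ρ fun _ => 1| + 1 with hB
  set B' := |K / Real.Gamma ρ| * (gammaMean ρ fun _ => 1) with hB'
  have hg0 : 0 ≤ gammaMean ρ fun _ => 1 :=
    setIntegral_nonneg measurableSet_Ioi fun u hu => by
      have : 0 < u := hu
      positivity
  have hBpos : 0 < B := by positivity
  have hB'0 : 0 ≤ B' := by positivity
  rw [Metric.tendsto_atTop']
  intro e he
  obtain ⟨p, hp⟩ := exists_polynomial_near_of_continuousOn 0 1 ψ hψ (e / (2 * (B + B' + 1)))
    (by positivity)
  set d := e / (2 * (B + B' + 1)) with hd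
  have hde : d * (B + B' + 1) = e / 2 := by rw [hd]; field_simp
  have hd0 : 0 < d := by positivity
  have hP := (tendsto_abelMean_polynomial hρ ha0 ha hK p)
  have ev1 := (Metric.tendsto_nhds.mp hP) (e / 2) (by positivity)
  have ev2 : ∀ᶠ N in atTop, abelMean a ρ (fun _ => 1) N < B :=
    h1.eventually_lt_const ((le_abs_self _).trans_lt (lt_add_one _))
  obtain ⟨N0, h0⟩ := eventually_atTop.mp (ev1.and (ev2.and (eventually_gt_atTop 0)))
  refine ⟨N0, fun N hN => ?_⟩
  obtain ⟨g1, g2, hN0⟩ := h0 N hN.le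
  have hs := exp_neg_inv_mem hN0
  have k1 : |abelMean a ρ ψ N - abelMean a ρ (fun x => p.eval x) N| ≤
      d * abelMean a ρ (fun _ => 1) N := by
    simp only [abelMean]
    rw [← mul_sub, abs_mul, abs_of_nonneg (by positivity : (0 : ℝ) ≤ (N : ℝ) ^ (-ρ)),
      mul_left_comm d]
    refine mul_le_mul_of_nonneg_left ?_ (by positivity)
    rw [← (abelMean_summable ha0 ha hψ hN0).tsum_sub
      (abelMean_summable ha0 ha p.continuous.continuousOn hN0), ← tsum_mul_left, ← Real.norm_eq_abs]
    refine tsum_of_norm_bounded (Summable.hasSum ((((ha _ hs).mul_right 1)).mul_left d))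
      fun n => ?_
    have hx : Real.exp (-1 / N) ^ n ∈ Icc (0 : ℝ) 1 :=
      ⟨pow_nonneg hs.1.le _, pow_le_one₀ hs.1.le hs.2.le⟩
    rw [← mul_sub, norm_mul, Real.norm_of_nonneg (mul_nonneg (ha0 n) hx.1), mul_one, mul_comm d]
    refine mul_le_mul_of_nonneg_left ?_ (mul_nonneg (ha0 n) hx.1)
    rw [Real.norm_eq_abs, abs_sub_comm]
    exact (hp _ hx).le
  have k2 : |K / Real.Gamma ρ * gammaMean ρ ψ - K / Real.Gamma ρ * gammaMean ρ fun x => p.eval x|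
      ≤ d * B' := by
    rw [← mul_sub, abs_mul, hB', mul_left_comm]
    refine mul_le_mul_of_nonneg_left ?_ (abs_nonneg _)
    simp only [gammaMean]
    rw [← integral_sub (gammaMean_integrable hρ hψ)
      (gammaMean_integrable hρ p.continuous.continuousOn), ← integral_const_mul,
      ← Real.norm_eq_abs]
    refine norm_integral_le_of_norm_le
      ((gammaMean_integrable hρ (ψ := fun _ => 1) continuousOn_const).const_mul d) ?_
    filter_upwards [ae_restrict_mem measurableSet_Ioi] with u hu
    have hu' : 0 < u := hu
    have hx : Real.exp (-u) ∈ Icc (0 : ℝ) 1 := ⟨(Real.exp_pos _).le, by simpa using hu'.le⟩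
    have hw : 0 ≤ u ^ (ρ - 1) * Real.exp (-u) := by positivity
    rw [← mul_sub, norm_mul, Real.norm_of_nonneg hw, mul_one, mul_comm d]
    refine mul_le_mul_of_nonneg_left ?_ hw
    rw [Real.norm_eq_abs, abs_sub_comm]
    exact (hp _ hx).le
  rw [Real.dist_eq] at g1 ⊢
  have k3 : d * abelMean a ρ (fun _ => 1) N ≤ d * B := mul_le_mul_of_nonneg_left g2.le hd0.le
  rw [abs_lt] at g1 ⊢
  rw [abs_le] at k1 k2
  constructor <;> nlinarith

theorem tendsto_abelMean_one {ψ : ℝ → ℝ} (hψ : ContinuousOn ψ (Icc 0 1)) :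
    Tendsto (abelMean (fun _ => 1) 1 ψ) atTop (𝓝 (gammaMean 1 ψ)) := by
  have h := tendsto_abelMean (a := fun _ => 1) (ρ := 1) (K := 1) one_pos (fun _ => zero_le_one)
    (fun s hs => by simpa using summable_geometric_of_lt_one hs.1.le hs.2) ?_ hψ
  · simpa using h
  · refine tendsto_const_nhds.congr' ?_
    filter_upwards [Ioo_mem_nhdsLT zero_lt_one] with s hs
    have : 1 - s ≠ 0 := (sub_pos.mpr hs.2).ne'
    simp [tsum_geometric_of_lt_one hs.1.le hs.2, this]

/-- A nonnegative continuous bump supported on `[x, y]`. -/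
noncomputable def bump (x y z : ℝ) : ℝ := max 0 ((z - x) * (y - z))

theorem bump_nonneg (x y z : ℝ) : 0 ≤ bump x y z := le_max_left _ _

theorem continuous_bump (x y : ℝ) : Continuous (bump x y) := by unfold bump; fun_prop

theorem mem_of_bump_ne_zero {x y z : ℝ} (hxy : x ≤ y) (h : bump x y z ≠ 0) : x ≤ z ∧ z ≤ y := by
  have h' : 0 < (z - x) * (y - z) := by
    by_contra hc
    exact h (max_eq_left (not_lt.mp hc))
  constructor <;> by_contra hc <;> nlinarith

theorem gammaMean_bump_pos {α β : ℝ} (hα : 0 < α) (hαβ : α < β) :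
    0 < gammaMean 1 (bump (Real.exp (-β)) (Real.exp (-α))) := by
  rw [gammaMean, setIntegral_pos_iff_support_of_nonneg_ae]
  · refine lt_of_lt_of_le ?_ (measure_mono (s := Ioo α β) fun u hu => ⟨?_, hα.trans hu.1⟩)
    · simpa using hαβ
    · have h1 : Real.exp (-β) < Real.exp (-u) := Real.exp_lt_exp.mpr (neg_lt_neg hu.2)
      have h2 : Real.exp (-u) < Real.exp (-α) := Real.exp_lt_exp.mpr (neg_lt_neg hu.1)
      have : bump (Real.exp (-β)) (Real.exp (-α)) (Real.exp (-u)) ≠ 0 :=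
        (lt_max_of_lt_right (mul_pos (sub_pos.mpr h1) (sub_pos.mpr h2))).ne'
      simp [this, Real.exp_ne_zero]
  · filter_upwards [ae_restrict_mem measurableSet_Ioi] with u hu
    have : 0 < u := hu
    have := bump_nonneg (Real.exp (-β)) (Real.exp (-α)) (Real.exp (-u))
    simp only [Pi.zero_apply]
    positivity
  · exact gammaMean_integrable one_pos (continuous_bump _ _).continuousOn

theorem bump_support_nat {α β : ℝ} (hαβ : α < β) {N n : ℕ} (hN : 0 < N)
    (h : bump (Real.exp (-β)) (Real.exp (-α)) (Real.exp (-1 / N) ^ n) ≠ 0) :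
    α * N ≤ n ∧ n ≤ β * N := by
  have hNp : (0 : ℝ) < N := by exact_mod_cast hN
  have := mem_of_bump_ne_zero (Real.exp_le_exp.mpr (neg_le_neg hαβ.le)) h
  rw [← Real.exp_nat_mul, Real.exp_le_exp, Real.exp_le_exp] at this
  have e : (n : ℝ) * (-1 / N) = -(n / N) := by ring
  rw [e, neg_le_neg_iff, neg_le_neg_iff, div_le_iff₀ hNp, le_div_iff₀ hNp] at this
  exact this.symm

theorem tauberian_antitone {a : ℕ → ℝ} {ρ K : ℝ} (hρ : 0 < ρ) (hρ1 : ρ ≤ 1) (ha0 : ∀ n, 0 ≤ a n)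
    (ham : Antitone a) (hK0 : 0 ≤ K)
    (hK : Tendsto (fun s => (1 - s) ^ ρ * ∑' n, a n * s ^ n) (𝓝[<] 1) (𝓝 K)) :
    Tendsto (fun N : ℕ => (N : ℝ) ^ (1 - ρ) * a N) atTop (𝓝 (K / Real.Gamma ρ)) := by
  have ha : ∀ s ∈ Ioo (0 : ℝ) 1, Summable fun n => a n * s ^ n := fun s hs =>
    Summable.of_nonneg_of_le (fun n => mul_nonneg (ha0 n) (pow_nonneg hs.1.le n))
      (fun n => mul_le_mul_of_nonneg_right (ham n.zero_le) (pow_nonneg hs.1.le n))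
      ((summable_geometric_of_lt_one hs.1.le hs.2).mul_left _)
  set L := K / Real.Gamma ρ with hL
  have hL0 : 0 ≤ L := div_nonneg hK0 (Real.Gamma_pos_of_pos hρ).le
  have one_sum : ∀ s ∈ Ioo (0 : ℝ) 1, Summable fun n : ℕ => (1 : ℝ) * s ^ n := fun s hs => by
    simpa using summable_geometric_of_lt_one hs.1.le hs.2
  -- comparison of the two means when the bump lies on one side of `N`
  have resc : ∀ N : ℕ, 0 < N → ∀ ψ : ℝ → ℝ, (N : ℝ) ^ (1 - ρ) * a N * abelMean (fun _ => 1) 1 ψ N =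
      (N : ℝ) ^ (-ρ) * ∑' n, a N * (1 * Real.exp (-1 / N) ^ n * ψ (Real.exp (-1 / N) ^ n)) := by
    intro N hN ψ
    have hNp : (0 : ℝ) < N := by exact_mod_cast hN
    rw [abelMean, tsum_mul_left, sub_eq_add_neg, Real.rpow_add hNp, Real.rpow_one,
      Real.rpow_neg_one]
    field_simp
  refine tendsto_order.mpr ⟨fun c hc => ?_, fun c hc => ?_⟩
  · have hev : ∀ᶠ β in 𝓝[>] (1 : ℝ), c < L * β ^ (ρ - 1) := by
      have : Tendsto (fun β : ℝ => L * β ^ (ρ - 1)) (𝓝[>] 1) (𝓝 (L * 1 ^ (ρ - 1))) :=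
        ((Real.continuousAt_rpow_const 1 _ (Or.inl one_ne_zero)).const_mul
          L).tendsto.mono_left nhdsWithin_le_nhds
      rw [Real.one_rpow, mul_one] at this
      exact this.eventually_const_lt hc
    obtain ⟨β, hcβ, hβ⟩ := (hev.and self_mem_nhdsWithin).exists
    have hβ1 : 1 < β := hβ
    set ψ := bump (Real.exp (-β)) (Real.exp (-1)) with hψ
    have hcont : ContinuousOn ψ (Icc 0 1) := (continuous_bump _ _).continuousOn
    have hpos : 0 < gammaMean 1 ψ := gammaMean_bump_pos one_pos hβ1
    have hle : β ^ (ρ - 1) * gammaMean 1 ψ ≤ gammaMean ρ ψ := by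
      rw [gammaMean, gammaMean, ← integral_const_mul]
      refine setIntegral_mono_on ((gammaMean_integrable one_pos hcont).const_mul _)
        (gammaMean_integrable hρ hcont) measurableSet_Ioi fun u hu => ?_
      have hu' : 0 < u := hu
      by_cases h0 : ψ (Real.exp (-u)) = 0
      · simp [h0]
      · have := mem_of_bump_ne_zero (Real.exp_le_exp.mpr (neg_le_neg hβ1.le)) h0
        rw [Real.exp_le_exp, Real.exp_le_exp, neg_le_neg_iff, neg_le_neg_iff] at this
        rw [sub_self, Real.rpow_zero, one_mul, mul_assoc]
        exact mul_le_mul_of_nonneg_right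
          (Real.rpow_le_rpow_of_nonpos hu' this.1 (by linarith))
          (mul_nonneg (Real.exp_pos _).le (bump_nonneg _ _ _))
    have hlim := (tendsto_abelMean hρ ha0 ha hK hcont).div (tendsto_abelMean_one hcont) hpos.ne'
    have hlt : c < L * gammaMean ρ ψ / gammaMean 1 ψ := by
      refine hcβ.trans_le ?_
      rw [le_div_iff₀ hpos, mul_assoc]
      exact mul_le_mul_of_nonneg_left hle hL0
    filter_upwards [hlim.eventually_const_lt hlt, eventually_gt_atTop 0,
      (tendsto_abelMean_one hcont).eventually_const_lt hpos] with N h1 hN h2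
    refine h1.trans_le ?_
    rw [Pi.div_apply, div_le_iff₀ h2, resc N hN, abelMean]
    refine mul_le_mul_of_nonneg_left ?_ (by positivity)
    refine (abelMean_summable ha0 ha hcont hN).tsum_le_tsum (fun n => ?_)
      ((abelMean_summable (fun _ => zero_le_one) one_sum hcont hN).mul_left _)
    by_cases h0 : ψ (Real.exp (-1 / N) ^ n) = 0
    · simp [h0]
    · have := (bump_support_nat hβ1 hN h0).1
      rw [one_mul] at this
      rw [one_mul, mul_assoc]
      exact mul_le_mul_of_nonneg_right (ham (by exact_mod_cast this))
        (mul_nonneg (by positivity) (bump_nonneg _ _ _))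
  · have hev : ∀ᶠ β in 𝓝[<] (1 : ℝ), L * β ^ (ρ - 1) < c := by
      have : Tendsto (fun β : ℝ => L * β ^ (ρ - 1)) (𝓝[<] 1) (𝓝 (L * 1 ^ (ρ - 1))) :=
        ((Real.continuousAt_rpow_const 1 _ (Or.inl one_ne_zero)).const_mul
          L).tendsto.mono_left nhdsWithin_le_nhds
      rw [Real.one_rpow, mul_one] at this
      exact this.eventually_lt_const hc
    obtain ⟨α, hcα, hα0, hα1⟩ := (hev.and (Ioo_mem_nhdsLT zero_lt_one)).exists
    set ψ := bump (Real.exp (-1)) (Real.exp (-α)) with hψ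
    have hcont : ContinuousOn ψ (Icc 0 1) := (continuous_bump _ _).continuousOn
    have hpos : 0 < gammaMean 1 ψ := gammaMean_bump_pos hα0 hα1
    have hle : gammaMean ρ ψ ≤ α ^ (ρ - 1) * gammaMean 1 ψ := by
      rw [gammaMean, gammaMean, ← integral_const_mul]
      refine setIntegral_mono_on (gammaMean_integrable hρ hcont)
        ((gammaMean_integrable one_pos hcont).const_mul _) measurableSet_Ioi fun u hu => ?_
      have hu' : 0 < u := hu
      by_cases h0 : ψ (Real.exp (-u)) = 0
      · simp [h0]
      · have := mem_of_bump_ne_zero (Real.exp_le_exp.mpr (neg_le_neg hα1.le)) h0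
        rw [Real.exp_le_exp, Real.exp_le_exp, neg_le_neg_iff, neg_le_neg_iff] at this
        rw [sub_self, Real.rpow_zero, one_mul, mul_assoc]
        exact mul_le_mul_of_nonneg_right
          (Real.rpow_le_rpow_of_nonpos hα0 this.2 (by linarith))
          (mul_nonneg (Real.exp_pos _).le (bump_nonneg _ _ _))
    have hlim := (tendsto_abelMean hρ ha0 ha hK hcont).div (tendsto_abelMean_one hcont) hpos.ne'
    have hlt : L * gammaMean ρ ψ / gammaMean 1 ψ < c := by
      refine lt_of_le_of_lt ?_ hcα
      rw [div_le_iff₀ hpos, mul_assoc]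
      exact mul_le_mul_of_nonneg_left hle hL0
    filter_upwards [hlim.eventually_lt_const hlt, eventually_gt_atTop 0,
      (tendsto_abelMean_one hcont).eventually_const_lt hpos] with N h1 hN h2
    refine lt_of_le_of_lt ?_ h1
    rw [Pi.div_apply, le_div_iff₀ h2, resc N hN, abelMean]
    refine mul_le_mul_of_nonneg_left ?_ (by positivity)
    refine ((abelMean_summable (fun _ => zero_le_one) one_sum hcont hN).mul_left _).tsum_le_tsum
      (fun n => ?_) (abelMean_summable ha0 ha hcont hN)
    by_cases h0 : ψ (Real.exp (-1 / N) ^ n) = 0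
    · simp [h0]
    · have := (bump_support_nat hα1 hN h0).2
      rw [one_mul] at this
      rw [one_mul, mul_assoc]
      exact mul_le_mul_of_nonneg_right (ham (by exact_mod_cast this))
        (mul_nonneg (by positivity) (bump_nonneg _ _ _))

end Tauberian

/-- The sum of `f` over the four lattice neighbours of `p`. -/
def nbrSum {R : Type*} [Add R] (f : ℤ × ℤ → R) (p : ℤ × ℤ) : R :=
  f (p.1 + 1, p.2) + f (p.1 - 1, p.2) + f (p.1, p.2 + 1) + f (p.1, p.2 - 1)

/-- The walks counted by `walkCountAll squareSteps coneC a n`. -/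
abbrev ConeWalk (a : ℤ × ℤ) (n : ℕ) : Type :=
  {w : Fin (n+1) → ℤ × ℤ //
    w 0 = a ∧ (∀ k : Fin n, w k.succ - w k.castSucc ∈ squareSteps) ∧ (∀ k, w k ∈ coneC)}

/-- The four lattice neighbours of a point. -/
def nbrs (a : ℤ × ℤ) : Finset (ℤ × ℤ) :=
  {(a.1 + 1, a.2), (a.1 - 1, a.2), (a.1, a.2 + 1), (a.1, a.2 - 1)}

theorem mem_nbrs {a b : ℤ × ℤ} : b ∈ nbrs a ↔ b - a ∈ squareSteps := by
  obtain ⟨a1, a2⟩ := a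
  obtain ⟨b1, b2⟩ := b
  simp only [nbrs, squareSteps, Finset.mem_insert, Finset.mem_singleton, Set.mem_insert_iff,
    Set.mem_singleton_iff, Prod.mk.injEq, Prod.mk_sub_mk]
  omega

theorem sum_nbrs (f : ℤ × ℤ → ℕ) (a : ℤ × ℤ) : ∑ b ∈ nbrs a, f b = nbrSum f a := by
  obtain ⟨a1, a2⟩ := a
  rw [nbrs, Finset.sum_insert, Finset.sum_insert, Finset.sum_insert, Finset.sum_singleton]
  · simp only [nbrSum]; ring
  all_goals
    simp only [Finset.mem_insert, Finset.mem_singleton, Prod.mk.injEq]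
    omega

theorem sigma_coneWalk_ext {a : ℤ × ℤ} {n : ℕ} {x y : Σ b : nbrs a, ConeWalk b n}
    (h : x.2.1 = y.2.1) : x = y := by
  obtain ⟨⟨b, hb⟩, w⟩ := x
  obtain ⟨⟨b', hb'⟩, w'⟩ := y
  obtain rfl : b = b' := w.2.1.symm.trans ((congrFun h 0).trans w'.2.1)
  exact congrArg (Sigma.mk _) (Subtype.ext h)

/-- Splitting off the first step of a walk. -/
def coneWalkSuccEquiv {a : ℤ × ℤ} (ha : a ∈ coneC) (n : ℕ) :
    ConeWalk a (n + 1) ≃ Σ b : nbrs a, ConeWalk b n where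
  toFun w := ⟨⟨w.1 1, mem_nbrs.mpr (by have := w.2.2.1 0; rwa [Fin.castSucc_zero, w.2.1] at this)⟩,
    ⟨Fin.tail w.1, rfl, fun k => w.2.2.1 k.succ, fun k => w.2.2.2 k.succ⟩⟩
  invFun x := ⟨Fin.cons a x.2.1, rfl, fun k => by
      refine Fin.cases ?_ (fun j => ?_) k
      · have := mem_nbrs.mp x.1.2
        rw [← x.2.2.1] at this
        exact this
      · exact x.2.2.2.1 j,
    fun k => by
      refine Fin.cases ?_ (fun j => ?_) k
      · exact ha
      · exact x.2.2.2.2 j⟩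
  left_inv w := by
    apply Subtype.ext
    change Fin.cons a (Fin.tail w.1) = w.1
    have := Fin.cons_self_tail w.1
    rwa [w.2.1] at this
  right_inv _ := sigma_coneWalk_ext rfl

instance coneWalk_finite (a : ℤ × ℤ) (n : ℕ) : Finite (ConeWalk a n) := by
  induction n generalizing a with
  | zero =>
    refine @Finite.of_subsingleton _ ⟨fun v w => Subtype.ext (funext fun k => ?_)⟩
    rw [show k = 0 from Fin.ext (by omega), v.2.1, w.2.1]
  | succ n ih =>
    by_cases ha : a ∈ coneC
    · have := fun b : nbrs a => ih b
      exact Finite.of_equiv _ (coneWalkSuccEquiv ha n).symm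
    · have : IsEmpty (ConeWalk a (n + 1)) := ⟨fun w => ha (w.2.1 ▸ w.2.2.2 0)⟩
      infer_instance

theorem walkCountAll_eq (a : ℤ × ℤ) (n : ℕ) :
    walkCountAll squareSteps coneC a n = Nat.card (ConeWalk a n) := rfl

theorem walkCountAll_of_notMem {a : ℤ × ℤ} (ha : a ∉ coneC) (n : ℕ) :
    walkCountAll squareSteps coneC a n = 0 := by
  rw [walkCountAll_eq]
  have : IsEmpty (ConeWalk a n) := ⟨fun w => ha (w.2.1 ▸ w.2.2.2 0)⟩
  exact Nat.card_of_isEmpty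

theorem walkCountAll_zero {a : ℤ × ℤ} (ha : a ∈ coneC) :
    walkCountAll squareSteps coneC a 0 = 1 := by
  rw [walkCountAll_eq, Nat.card_eq_one_iff_unique]
  refine ⟨⟨fun v w => Subtype.ext (funext fun k => ?_)⟩,
    ⟨fun _ => a, rfl, fun k => k.elim0, fun _ => ha⟩⟩
  rw [show k = 0 from Fin.ext (by omega), v.2.1, w.2.1]

theorem walkCountAll_succ {a : ℤ × ℤ} (ha : a ∈ coneC) (n : ℕ) :
    walkCountAll squareSteps coneC a (n + 1) =
      nbrSum (fun b => walkCountAll squareSteps coneC b n) a := by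
  rw [walkCountAll_eq, Nat.card_congr (coneWalkSuccEquiv ha n), Nat.card_sigma, ← sum_nbrs]
  exact Finset.sum_coe_sort (nbrs a) fun b => walkCountAll squareSteps coneC b n

theorem walkCountAll_le (a : ℤ × ℤ) (n : ℕ) : walkCountAll squareSteps coneC a n ≤ 4 ^ n := by
  induction n generalizing a with
  | zero =>
    by_cases ha : a ∈ coneC
    · rw [walkCountAll_zero ha, pow_zero]
    · rw [walkCountAll_of_notMem ha]; exact Nat.zero_le _
  | succ n ih =>
    by_cases ha : a ∈ coneC
    · rw [walkCountAll_succ ha, nbrSum, pow_succ]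
      linarith [ih (a.1 + 1, a.2), ih (a.1 - 1, a.2), ih (a.1, a.2 + 1), ih (a.1, a.2 - 1)]
    · rw [walkCountAll_of_notMem ha]; exact Nat.zero_le _

theorem walkCountAll_succ_le (a : ℤ × ℤ) (n : ℕ) :
    walkCountAll squareSteps coneC a (n + 1) ≤ 4 * walkCountAll squareSteps coneC a n := by
  induction n generalizing a with
  | zero =>
    by_cases ha : a ∈ coneC
    · rw [walkCountAll_zero ha]; simpa using walkCountAll_le a 1
    · rw [walkCountAll_of_notMem ha]; exact Nat.zero_le _
  | succ n ih =>
    by_cases ha : a ∈ coneC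
    · rw [walkCountAll_succ ha (n + 1), walkCountAll_succ ha n, nbrSum, nbrSum]
      linarith [ih (a.1 + 1, a.2), ih (a.1 - 1, a.2), ih (a.1, a.2 + 1), ih (a.1, a.2 - 1)]
    · rw [walkCountAll_of_notMem ha]; exact Nat.zero_le _

section Green

open Set Filter Topology

variable {𝕜 : Type*} [NormedField 𝕜]

theorem nbrSum_eq_translates {R : Type*} [Add R] (f : ℤ × ℤ → R) (p : ℤ × ℤ) :
    nbrSum f p = f (p + (1, 0)) + f (p + (-1, 0)) + f (p + (0, 1)) + f (p + (0, -1)) := by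
  simp [nbrSum, Prod.add_def, sub_eq_add_neg]

theorem summable_norm_translate {f : ℤ × ℤ → 𝕜} (hf : Summable fun p => ‖f p‖) (d : ℤ × ℤ) :
    Summable fun p => ‖f (p + d)‖ :=
  (Equiv.addRight d).summable_iff.mpr hf

theorem summable_norm_mul_bounded {f χ : ℤ × ℤ → 𝕜} (hf : Summable fun p => ‖f p‖) {M : ℝ}
    (hχ : ∀ p, ‖χ p‖ ≤ M) : Summable fun p => ‖f p * χ p‖ :=
  Summable.of_nonneg_of_le (fun _ => norm_nonneg _)
    (fun p => by rw [norm_mul]; exact mul_le_mul_of_nonneg_left (hχ p) (norm_nonneg _))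
    (hf.mul_right M)

theorem tsum_nbrSum_mul [CompleteSpace 𝕜] {f χ : ℤ × ℤ → 𝕜} (hf : Summable fun p => ‖f p‖) {M : ℝ}
    (hχ : ∀ p, ‖χ p‖ ≤ M) : ∑' p, nbrSum f p * χ p = ∑' p, f p * nbrSum χ p := by
  have key : ∀ d : ℤ × ℤ, ∑' p, f (p + d) * χ p = ∑' p, f p * χ (p + -d) := fun d => by
    rw [← (Equiv.addRight d).tsum_eq fun p => f p * χ (p + -d)]
    simp
  have s1 : ∀ d : ℤ × ℤ, Summable fun p => f (p + d) * χ p := fun d =>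
    (summable_norm_mul_bounded (summable_norm_translate hf d) hχ).of_norm
  have s2 : ∀ d : ℤ × ℤ, Summable fun p => f p * χ (p + d) := fun d =>
    (summable_norm_mul_bounded hf fun p => hχ (p + d)).of_norm
  simp only [nbrSum_eq_translates, add_mul, mul_add]
  rw [(((s1 _).add (s1 _)).add (s1 _)).tsum_add (s1 _), ((s1 _).add (s1 _)).tsum_add (s1 _),
    (s1 _).tsum_add (s1 _), (((s2 _).add (s2 _)).add (s2 _)).tsum_add (s2 _),
    ((s2 _).add (s2 _)).tsum_add (s2 _), (s2 _).tsum_add (s2 _), key, key, key, key]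
  simp only [Prod.neg_mk, neg_zero, neg_neg]
  ring

/-- `f` is the summable solution of `f = src + t * nbrSum f` in the cone with zero boundary
values. -/
structure IsGreen (t : 𝕜) (src f : ℤ × ℤ → 𝕜) : Prop where
  summable : Summable fun p => ‖f p‖
  off : ∀ p ∉ coneC, f p = 0
  eq : ∀ p ∈ coneC, f p = src p + t * nbrSum f p

theorem IsGreen.duality [CompleteSpace 𝕜] {t : 𝕜} {src f χ : ℤ × ℤ → 𝕜} (h : IsGreen t src f) {M : ℝ}
    (hχ : ∀ p, ‖χ p‖ ≤ M) (hoff : ∀ p ∉ coneC, χ p = 0) (hs : Summable fun p => src p * χ p) :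
    ∑' p, f p * (χ p - t * nbrSum χ p) = ∑' p, src p * χ p := by
  have hn : ∀ p, ‖nbrSum χ p‖ ≤ M + M + M + M := fun p =>
    (norm_add₄_le).trans (by gcongr <;> exact hχ _)
  have s1 : Summable fun p => f p * χ p := (summable_norm_mul_bounded h.summable hχ).of_norm
  have s2 : Summable fun p => f p * nbrSum χ p :=
    (summable_norm_mul_bounded h.summable hn).of_norm
  have e1 : ∀ p, f p * χ p - src p * χ p = t * (nbrSum f p * χ p) := fun p => by
    by_cases hp : p ∈ coneC
    · conv_lhs => rw [h.eq p hp]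
      ring
    · rw [hoff p hp]; ring
  have e2 : ∑' p, f p * χ p - ∑' p, src p * χ p = t * ∑' p, f p * nbrSum χ p := by
    rw [← s1.tsum_sub hs, tsum_congr e1, tsum_mul_left, tsum_nbrSum_mul h.summable hχ]
  have e3 : ∑' p, f p * (χ p - t * nbrSum χ p) =
      ∑' p, f p * χ p - t * ∑' p, f p * nbrSum χ p := by
    rw [← tsum_mul_left, ← s1.tsum_sub (s2.mul_left t)]
    exact tsum_congr fun p => by ring
  rw [e3, ← e2]
  ring

/-- Iterated weighted walks issued from `src`, killed outside the cone. -/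
noncomputable def killedIter (src : ℤ × ℤ → ℝ) : ℕ → ℤ × ℤ → ℝ
  | 0 => src
  | n + 1 => coneC.indicator (nbrSum (killedIter src n))

theorem killedIter_nonneg {src : ℤ × ℤ → ℝ} (h : ∀ p, 0 ≤ src p) (n : ℕ) (p : ℤ × ℤ) :
    0 ≤ killedIter src n p := by
  induction n generalizing p with
  | zero => exact h p
  | succ n ih =>
    exact indicator_nonneg (fun q _ => add_nonneg (add_nonneg (add_nonneg (ih _) (ih _)) (ih _))
      (ih _)) p

theorem killedIter_summable {src : ℤ × ℤ → ℝ} (h : ∀ p, 0 ≤ src p) (hs : Summable src) (n : ℕ) :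
    Summable (killedIter src n) ∧ ∑' p, killedIter src n p ≤ 4 ^ n * ∑' p, src p := by
  induction n with
  | zero => simpa [killedIter] using hs
  | succ n ih =>
    have h0 := killedIter_nonneg h n
    set g := killedIter src n
    have hg : Summable fun p => ‖g p‖ := ih.1.norm
    have s := fun d => (summable_norm_translate hg d).of_norm
    have hsum : Summable (nbrSum g) := by
      rw [funext (nbrSum_eq_translates g)]
      exact (((s _).add (s _)).add (s _)).add (s _)
    have htsum : ∑' p, nbrSum g p = 4 * ∑' p, g p := by
      have := tsum_nbrSum_mul (f := g) (χ := fun _ => 1) (M := 1) hg (by simp)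
      simp only [mul_one, nbrSum, tsum_mul_right] at this
      rw [show (fun p => nbrSum g p) = fun p => nbrSum g p from rfl]
      simp only [nbrSum, this]
      ring
    have hind : Summable (coneC.indicator (nbrSum g)) := hsum.indicator _
    refine ⟨hind, (hind.tsum_le_tsum (fun p => ?_) hsum).trans ?_⟩
    · exact indicator_le_self' (fun q _ => add_nonneg (add_nonneg (add_nonneg (h0 _) (h0 _))
        (h0 _)) (h0 _)) p
    · rw [htsum, pow_succ']
      linarith [ih.2]

theorem nbrSum_swap {R : Type*} [AddCommSemigroup R] {f : ℤ × ℤ → R} (h : ∀ p, f p.swap = f p)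
    (p : ℤ × ℤ) : nbrSum f p.swap = nbrSum f p := by
  obtain ⟨i, j⟩ := p
  have := h (i + 1, j)
  have := h (i - 1, j)
  have := h (i, j + 1)
  have := h (i, j - 1)
  simp only [Prod.swap, nbrSum] at *
  simp only [*]
  ac_rfl

theorem swap_mem_coneC {p : ℤ × ℤ} : p.swap ∈ coneC ↔ p ∈ coneC := or_comm

theorem killedIter_swap {src : ℤ × ℤ → ℝ} (h : ∀ p, src p.swap = src p) (n : ℕ) (p : ℤ × ℤ) :
    killedIter src n p.swap = killedIter src n p := by
  induction n generalizing p with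
  | zero => exact h p
  | succ n ih =>
    by_cases hp : p ∈ coneC
    · rw [killedIter, indicator_of_mem hp, indicator_of_mem (swap_mem_coneC.mpr hp),
        nbrSum_swap ih]
    · rw [killedIter, indicator_of_notMem hp, indicator_of_notMem (mt swap_mem_coneC.mp hp)]

theorem exists_isGreen {t : ℝ} (ht0 : 0 < t) (ht : t < 1 / 4) {src : ℤ × ℤ → ℝ}
    (h : ∀ p, 0 ≤ src p) (hs : Summable src) (hoff : ∀ p ∉ coneC, src p = 0)
    (hsym : ∀ p, src p.swap = src p) :
    ∃ f, IsGreen t src f ∧ (∀ p, 0 ≤ f p) ∧ ∀ p, f p.swap = f p := by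
  have h0 := killedIter_nonneg h
  have hS := killedIter_summable h hs
  have hF0 : ∀ n p, 0 ≤ t ^ n * killedIter src n p := fun n p =>
    mul_nonneg (pow_nonneg ht0.le _) (h0 _ _)
  have hFs : Summable fun x : ℕ × (ℤ × ℤ) => t ^ x.1 * killedIter src x.1 x.2 := by
    rw [summable_prod_of_nonneg fun x => hF0 x.1 x.2]
    refine ⟨fun n => (hS n).1.mul_left (t ^ n), ?_⟩
    refine Summable.of_nonneg_of_le (fun n => tsum_nonneg fun p => hF0 n p) (fun n => ?_)
      ((summable_geometric_of_lt_one (r := 4 * t) (by positivity) (by linarith)).mul_right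
        (∑' p, src p))
    change ∑' p, t ^ n * killedIter src n p ≤ _
    rw [tsum_mul_left, mul_pow, mul_right_comm, mul_comm]
    exact mul_le_mul_of_nonneg_right (hS n).2 (by positivity)
  have hFs' : Summable fun x : (ℤ × ℤ) × ℕ => t ^ x.2 * killedIter src x.2 x.1 :=
    (Equiv.prodComm (ℤ × ℤ) ℕ).summable_iff.mpr hFs
  have hfib : ∀ p, Summable fun n => t ^ n * killedIter src n p := fun p =>
    hFs'.prod_factor p
  refine ⟨fun p => ∑' n, t ^ n * killedIter src n p, ⟨?_, fun p hp => ?_, fun p hp => ?_⟩,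
    fun p => tsum_nonneg fun n => hF0 n p, fun p => ?_⟩
  · exact hFs'.prod.norm
  · refine (tsum_congr fun n => ?_).trans tsum_zero
    cases n with
    | zero => simp [killedIter, hoff p hp]
    | succ n => simp [killedIter, hp]
  · rw [(hfib p).tsum_eq_zero_add]
    simp only [pow_zero, one_mul]
    congr 1
    simp only [killedIter, indicator_of_mem hp, nbrSum]
    rw [← (hfib _).tsum_add (hfib _), ← ((hfib _).add (hfib _)).tsum_add (hfib _),
      ← (((hfib _).add (hfib _)).add (hfib _)).tsum_add (hfib _), ← tsum_mul_left]
    exact tsum_congr fun n => by ring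
  · simp only [killedIter_swap hsym]

theorem IsGreen.ofReal {t : ℝ} {src f : ℤ × ℤ → ℝ} (h : IsGreen t src f) :
    IsGreen (t : ℂ) (fun p => (src p : ℂ)) (fun p => (f p : ℂ)) where
  summable := by simpa using h.summable
  off p hp := by simp [h.off p hp]
  eq p hp := by
    rw [h.eq p hp]
    simp [nbrSum]

theorem nonneg_of_supersolution {t : ℝ} (ht0 : 0 < t) (ht : t < 1 / 4) {g : ℤ × ℤ → ℝ}
    {R : Set (ℤ × ℤ)} {M : ℝ} (hM : ∀ p, -M ≤ g p) (hoff : ∀ p ∉ R, 0 ≤ g p)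
    (hR : ∀ p ∈ R, t * nbrSum g p ≤ g p) (p : ℤ × ℤ) : 0 ≤ g p := by
  have hM0 : ∀ p, -|M| ≤ g p := fun p => (neg_le_neg (le_abs_self M)).trans (hM p)
  have key : ∀ k : ℕ, ∀ p, -((4 * t) ^ k * |M|) ≤ g p := by
    intro k
    induction k with
    | zero => simpa using hM0
    | succ k ih =>
      intro p
      by_cases hp : p ∈ R
      · refine le_trans ?_ (hR p hp)
        have : 4 * -((4 * t) ^ k * |M|) ≤ nbrSum g p := by
          rw [nbrSum]
          linarith [ih (p.1 + 1, p.2), ih (p.1 - 1, p.2), ih (p.1, p.2 + 1), ih (p.1, p.2 - 1)]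
        calc _ = t * (4 * -((4 * t) ^ k * |M|)) := by ring
          _ ≤ _ := mul_le_mul_of_nonneg_left this ht0.le
      · exact le_trans (by rw [neg_nonpos]; positivity) (hoff p hp)
  have hlim : Tendsto (fun k : ℕ => -((4 * t) ^ k * |M|)) atTop (𝓝 0) := by
    simpa using ((tendsto_pow_atTop_nhds_zero_of_lt_one (by positivity : 0 ≤ 4 * t)
      (by linarith)).mul_const |M|).neg
  exact le_of_tendsto' hlim fun k => key k p

end Green

section ConeGreen

open Set Filter Topology

theorem mem_coneC {i j : ℤ} : (i, j) ∈ coneC ↔ 0 ≤ i ∨ 0 ≤ j := Iff.rfl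

/-- The length generating function of walks in the cone started at `p`. -/
noncomputable def coneGF (t : ℝ) (p : ℤ × ℤ) : ℝ :=
  ∑' n, t ^ n * (walkCountAll squareSteps coneC p n : ℝ)

theorem coneGF_term_le {t : ℝ} (ht0 : 0 < t) (p : ℤ × ℤ) (n : ℕ) :
    t ^ n * (walkCountAll squareSteps coneC p n : ℝ) ≤ (4 * t) ^ n := by
  rw [mul_pow, mul_comm]
  exact mul_le_mul_of_nonneg_right (by exact_mod_cast walkCountAll_le p n) (by positivity)

theorem coneGF_summable {t : ℝ} (ht0 : 0 < t) (ht : t < 1 / 4) (p : ℤ × ℤ) :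
    Summable fun n => t ^ n * (walkCountAll squareSteps coneC p n : ℝ) :=
  Summable.of_nonneg_of_le (fun _ => by positivity) (coneGF_term_le ht0 p)
    (summable_geometric_of_lt_one (by positivity) (by linarith))

theorem coneGF_nonneg {t : ℝ} (ht0 : 0 < t) (p : ℤ × ℤ) : 0 ≤ coneGF t p :=
  tsum_nonneg fun _ => by positivity

theorem coneGF_le {t : ℝ} (ht0 : 0 < t) (ht : t < 1 / 4) (p : ℤ × ℤ) :
    coneGF t p ≤ (1 - 4 * t)⁻¹ := by
  rw [← tsum_geometric_of_lt_one (by positivity : 0 ≤ 4 * t) (by linarith)]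
  exact (coneGF_summable ht0 ht p).tsum_le_tsum (coneGF_term_le ht0 p)
    (summable_geometric_of_lt_one (by positivity) (by linarith))

theorem coneGF_off (t : ℝ) {p : ℤ × ℤ} (hp : p ∉ coneC) : coneGF t p = 0 := by
  simp [coneGF, walkCountAll_of_notMem hp]

theorem coneGF_eq {t : ℝ} (ht0 : 0 < t) (ht : t < 1 / 4) {p : ℤ × ℤ} (hp : p ∈ coneC) :
    coneGF t p = 1 + t * nbrSum (coneGF t) p := by
  have s := coneGF_summable ht0 ht
  simp only [coneGF, nbrSum]
  rw [(s p).tsum_eq_zero_add, walkCountAll_zero hp, ← (s _).tsum_add (s _),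
    ← ((s _).add (s _)).tsum_add (s _), ← (((s _).add (s _)).add (s _)).tsum_add (s _),
    ← tsum_mul_left]
  simp only [pow_zero, Nat.cast_one, mul_one]
  congr 1
  refine tsum_congr fun n => ?_
  rw [walkCountAll_succ hp, nbrSum]
  push_cast
  ring

/-- The reflected combination of `coneGF` that vanishes on the boundary of the quadrant. -/
noncomputable def quadGF (t : ℝ) (p : ℤ × ℤ) : ℝ :=
  coneGF t (-2 - p.1, p.2) + coneGF t (p.1, -2 - p.2) - coneGF t p

theorem quadGF_eq {t : ℝ} (ht0 : 0 < t) (ht : t < 1 / 4) {i j : ℤ} (hi : 0 ≤ i) (hj : 0 ≤ j) :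
    quadGF t (i, j) = 1 + t * nbrSum (quadGF t) (i, j) := by
  have h1 := coneGF_eq ht0 ht (mem_coneC.mpr (Or.inr hj) : (-2 - i, j) ∈ coneC)
  have h2 := coneGF_eq ht0 ht (mem_coneC.mpr (Or.inl hi) : (i, -2 - j) ∈ coneC)
  have h3 := coneGF_eq ht0 ht (mem_coneC.mpr (Or.inl hi) : (i, j) ∈ coneC)
  simp only [quadGF, nbrSum] at *
  rw [show (-2 - (i + 1)) = -2 - i - 1 by ring, show (-2 - (i - 1)) = -2 - i + 1 by ring,
    show (-2 - (j + 1)) = -2 - j - 1 by ring, show (-2 - (j - 1)) = -2 - j + 1 by ring]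
  linear_combination h1 + h2 - h3

theorem quadGF_left (t : ℝ) {j : ℤ} (hj : 0 ≤ j) : quadGF t (-1, j) = 0 := by
  have : coneGF t (-1, -2 - j) = 0 := coneGF_off t (by rw [mem_coneC]; omega)
  simp [quadGF, this]

theorem quadGF_bottom (t : ℝ) {i : ℤ} (hi : 0 ≤ i) : quadGF t (i, -1) = 0 := by
  have : coneGF t (-2 - i, -1) = 0 := coneGF_off t (by rw [mem_coneC]; omega)
  simp [quadGF, this]

theorem quadGF_le {t : ℝ} (ht0 : 0 < t) (ht : t < 1 / 4) (p : ℤ × ℤ) :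
    |quadGF t p| ≤ 2 * (1 - 4 * t)⁻¹ := by
  have l := coneGF_le ht0 ht
  have n := coneGF_nonneg ht0
  rw [quadGF, abs_le]
  constructor <;> linarith [l (-2 - p.1, p.2), l (p.1, -2 - p.2), l p, n (-2 - p.1, p.2),
    n (p.1, -2 - p.2), n p]

theorem nbrSum_indicator_quadGF (t : ℝ) {i j : ℤ} (hi : 0 ≤ i) (hj : 0 ≤ j) :
    nbrSum (quadQ.indicator (quadGF t)) (i, j) = nbrSum (quadGF t) (i, j) := by
  have e : ∀ p : ℤ × ℤ, -1 ≤ p.1 → -1 ≤ p.2 → (0 ≤ p.1 ∨ 0 ≤ p.2) →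
      quadQ.indicator (quadGF t) p = quadGF t p := by
    rintro ⟨i, j⟩ h1 h2 h3
    by_cases hp : (i, j) ∈ quadQ
    · rw [indicator_of_mem hp]
    · rw [indicator_of_notMem hp]
      have hp' : ¬(0 ≤ i ∧ 0 ≤ j) := hp
      simp only at h1 h2 h3
      rcases lt_or_ge i 0 with hi | hi
      · obtain rfl : i = -1 := by omega
        rw [quadGF_left t (by omega)]
      · obtain rfl : j = -1 := by omega
        rw [quadGF_bottom t hi]
  simp only [nbrSum]
  rw [e, e, e, e] <;> simp only <;> omega

theorem quadGF_nonneg {t : ℝ} (ht0 : 0 < t) (ht : t < 1 / 4) : 0 ≤ quadGF t (0, 0) := by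
  have h0 : ((0 : ℤ), (0 : ℤ)) ∈ quadQ := ⟨le_rfl, le_rfl⟩
  rw [← indicator_of_mem h0 (quadGF t)]
  refine nonneg_of_supersolution ht0 ht (R := quadQ) (M := 2 * (1 - 4 * t)⁻¹) (fun p => ?_)
    (fun p hp => by rw [indicator_of_notMem hp]) (fun p hp => ?_) _
  · have h1 : (0 : ℝ) < (1 - 4 * t)⁻¹ := inv_pos.mpr (by linarith)
    have h2 := quadGF_le ht0 ht p
    by_cases hp : p ∈ quadQ
    · rw [indicator_of_mem hp]; exact (abs_le.mp h2).1
    · rw [indicator_of_notMem hp]; linarith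
  · obtain ⟨i, j⟩ := p
    rw [nbrSum_indicator_quadGF t hp.1 hp.2, indicator_of_mem hp, quadGF_eq ht0 ht hp.1 hp.2]
    linarith

theorem quadGF_zero_le {t : ℝ} (ht0 : 0 < t) (ht : t < 1 / 4) :
    quadGF t (0, 0) ≤ 2 / Real.sqrt (1 - 4 * t) := by
  have hε : 0 < 1 - 4 * t := by linarith
  set r := Real.sqrt (1 - 4 * t) with hr
  have hr0 : 0 < r := Real.sqrt_pos.mpr hε
  have hr2 : r ^ 2 = 1 - 4 * t := Real.sq_sqrt hε.le
  have hr1 : r < 1 := by nlinarith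
  set l := (1 - r) / (1 + r) with hl
  have hl0 : 0 < l := div_pos (by linarith) (by linarith)
  have hl1 : l < 1 := by rw [hl, div_lt_one (by linarith)]; linarith
  have hlt : t * (2 + l + l⁻¹) = 1 := by
    have h1 : 1 - r ≠ 0 := by linarith
    have h2 : 1 + r ≠ 0 := by linarith
    rw [show t = (1 - r ^ 2) / 4 by linarith, hl]
    field_simp
    ring
  set ψ : ℤ → ℝ := fun i => (1 - l ^ (i + 1)) / (1 - 4 * t) with hψ
  have hψ0 : ∀ i, -1 ≤ i → 0 ≤ ψ i := fun i hi => by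
    obtain ⟨k, hk⟩ := Int.eq_ofNat_of_zero_le (by omega : 0 ≤ i + 1)
    refine div_nonneg ?_ hε.le
    rw [hk, sub_nonneg, zpow_natCast]
    exact pow_le_one₀ hl0.le hl1.le
  have hψe : ∀ i, t * (ψ (i + 1) + ψ (i - 1) + ψ i + ψ i) = ψ i - 1 := fun i => by
    have e1 : l ^ (i + 1 + 1) = l ^ (i + 1) * l := zpow_add_one₀ hl0.ne' _
    have e2 : l ^ (i - 1 + 1) = l ^ (i + 1) * l⁻¹ := by
      rw [← zpow_sub_one₀ hl0.ne']; congr 1; ring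
    simp only [hψ, e1, e2]
    generalize l ^ (i + 1) = A
    generalize l⁻¹ = k at hlt ⊢
    clear_value l
    linear_combination (-A * (1 - 4 * t)⁻¹) * hlt - mul_inv_cancel₀ hε.ne'
  set g : ℤ × ℤ → ℝ := fun p =>
    (if -1 ≤ p.1 then ψ p.1 else 0) - quadQ.indicator (quadGF t) p with hg
  have h0 : ((0 : ℤ), (0 : ℤ)) ∈ quadQ := ⟨le_rfl, le_rfl⟩
  have main : 0 ≤ g (0, 0) := by
    refine nonneg_of_supersolution ht0 ht (R := quadQ) (M := 2 * (1 - 4 * t)⁻¹) (fun p => ?_)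
      (fun p hp => ?_) (fun p hp => ?_) _
    · have h1 : (0 : ℝ) < (1 - 4 * t)⁻¹ := inv_pos.mpr hε
      have h2 := quadGF_le ht0 ht p
      have h3 : 0 ≤ if -1 ≤ p.1 then ψ p.1 else 0 := by
        split_ifs with h
        · exact hψ0 _ h
        · exact le_rfl
      simp only [hg]
      by_cases hp : p ∈ quadQ
      · rw [indicator_of_mem hp]; linarith [(abs_le.mp h2).2]
      · rw [indicator_of_notMem hp]; linarith
    · simp only [hg, indicator_of_notMem hp, sub_zero]
      split_ifs with h
      · exact hψ0 _ h
      · exact le_rfl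
    · obtain ⟨i, j⟩ := p
      have hi : 0 ≤ i := hp.1
      have e := nbrSum_indicator_quadGF t hp.1 hp.2
      have e' := quadGF_eq ht0 ht hp.1 hp.2
      have e'' := hψe i
      simp only [hg, nbrSum] at *
      rw [indicator_of_mem hp, if_pos (by omega), if_pos (by omega), if_pos (by omega)]
      linear_combination e'' - t * e + e'
  simp only [hg, indicator_of_mem h0, hψ] at main
  rw [if_pos (by norm_num)] at main
  have e : (1 - l ^ ((0 : ℤ) + 1)) / (1 - 4 * t) = 2 / (r * (1 + r)) := by
    have h2 : 1 + r ≠ 0 := by linarith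
    rw [← hr2, hl]
    simp only [zero_add, zpow_one]
    field_simp
    ring
  rw [e] at main
  have : 2 / (r * (1 + r)) ≤ 2 / r :=
    div_le_div_of_nonneg_left zero_le_two hr0 (by nlinarith)
  linarith

end ConeGreen

section ConeSources

open Set Filter Topology

/-- Unit masses at the two corner neighbours outside the quadrant. -/
def srcB (p : ℤ × ℤ) : ℝ := if p = (0, -1) ∨ p = (-1, 0) then 1 else 0

/-- The source dual to the reflected combination of generating functions. -/
def srcA (p : ℤ × ℤ) : ℝ :=
  if p = (0, 0) then 2 else if p = (-2, 0) ∨ p = (0, -2) then 1 else 0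

theorem srcB_nonneg (p : ℤ × ℤ) : 0 ≤ srcB p := by unfold srcB; split_ifs <;> norm_num

theorem srcA_nonneg (p : ℤ × ℤ) : 0 ≤ srcA p := by unfold srcA; split_ifs <;> norm_num

theorem srcB_eq_zero {p : ℤ × ℤ} (hp : p ∉ ({(0, -1), (-1, 0)} : Finset (ℤ × ℤ))) :
    srcB p = 0 := by
  simp only [Finset.mem_insert, Finset.mem_singleton] at hp
  exact if_neg hp

theorem srcA_eq_zero {p : ℤ × ℤ} (hp : p ∉ ({(0, 0), (-2, 0), (0, -2)} : Finset (ℤ × ℤ))) :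
    srcA p = 0 := by
  simp only [Finset.mem_insert, Finset.mem_singleton, not_or] at hp
  rw [srcA, if_neg hp.1, if_neg (not_or.mpr hp.2)]

theorem srcB_off {p : ℤ × ℤ} (hp : p ∉ coneC) : srcB p = 0 := by
  refine srcB_eq_zero fun h => hp ?_
  simp only [Finset.mem_insert, Finset.mem_singleton] at h
  rcases h with rfl | rfl <;> simp [mem_coneC]

theorem srcA_off {p : ℤ × ℤ} (hp : p ∉ coneC) : srcA p = 0 := by
  refine srcA_eq_zero fun h => hp ?_
  simp only [Finset.mem_insert, Finset.mem_singleton] at h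
  rcases h with rfl | rfl | rfl <;> simp [mem_coneC]

theorem srcB_swap (p : ℤ × ℤ) : srcB p.swap = srcB p := by
  obtain ⟨i, j⟩ := p
  simp only [srcB, Prod.swap, Prod.mk.injEq]
  congr 1
  rw [or_comm, and_comm, and_comm (a := j = 0)]

theorem srcA_swap (p : ℤ × ℤ) : srcA p.swap = srcA p := by
  obtain ⟨i, j⟩ := p
  simp only [srcA, Prod.swap, Prod.mk.injEq]
  congr 1
  · exact propext and_comm
  · congr 1
    rw [or_comm, and_comm, and_comm (a := j = -2)]

variable {𝕜 : Type*} [RCLike 𝕜]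

theorem hasSum_srcB (χ : ℤ × ℤ → 𝕜) :
    HasSum (fun p => ((srcB p : ℝ) : 𝕜) * χ p) (χ (0, -1) + χ (-1, 0)) := by
  have := hasSum_sum_of_ne_finset_zero (f := fun p => ((srcB p : ℝ) : 𝕜) * χ p)
    (s := {(0, -1), (-1, 0)}) (L := SummationFilter.unconditional _) fun p hp => by rw [srcB_eq_zero hp]; simp
  simpa [srcB] using this

theorem hasSum_srcA (χ : ℤ × ℤ → 𝕜) :
    HasSum (fun p => ((srcA p : ℝ) : 𝕜) * χ p) (2 * χ (0, 0) + χ (-2, 0) + χ (0, -2)) := by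
  have := hasSum_sum_of_ne_finset_zero (f := fun p => ((srcA p : ℝ) : 𝕜) * χ p)
    (s := {(0, 0), (-2, 0), (0, -2)}) (L := SummationFilter.unconditional _) fun p hp => by rw [srcA_eq_zero hp]; simp
  have h2 : ((2 : ℝ) : 𝕜) = 2 := by norm_cast
  simpa [srcA, add_assoc, h2] using this

theorem summable_srcB : Summable srcB := by simpa using (hasSum_srcB (𝕜 := ℝ) fun _ => 1).summable

theorem summable_srcA : Summable srcA := by simpa using (hasSum_srcA (𝕜 := ℝ) fun _ => 1).summable

theorem IsGreen.srcB_le {t : ℝ} (ht0 : 0 < t) (ht : t < 1 / 4) {u : ℤ × ℤ → ℝ}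
    (h : IsGreen t srcB u) (p : ℤ × ℤ) : u p ≤ 4 := by
  have hu : ∀ p, u p ≤ ∑' q, ‖u q‖ := fun p => (le_abs_self _).trans
    (h.summable.le_tsum p fun q _ => norm_nonneg _)
  have hT : 0 ≤ ∑' q, ‖u q‖ := tsum_nonneg fun q => norm_nonneg _
  set e : ℤ × ℤ → ℝ := coneC.indicator fun _ => 4 with he
  have he4 : ∀ p, e p ≤ 4 := fun p => indicator_le' (fun _ _ => le_rfl) (fun _ _ => by norm_num) p
  have he0 : ∀ p, 0 ≤ e p := fun p => indicator_nonneg (fun _ _ => by norm_num) p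
  have key := nonneg_of_supersolution (g := fun p => e p - u p) ht0 ht (R := coneC)
    (M := ∑' q, ‖u q‖) (fun p => by linarith [hu p, he0 p])
    (fun p hp => by rw [h.off p hp, sub_zero]; exact he0 p) (fun p hp => by
      have h1 := h.eq p hp
      have h2 : t * nbrSum e p + srcB p ≤ 4 := by
        by_cases hs : p = (0, -1) ∨ p = (-1, 0)
        · have : nbrSum e p ≤ 12 := by
            have z : e (-1, -1) = 0 := indicator_of_notMem (by rw [mem_coneC]; omega) _
            rcases hs with rfl | rfl
            · simp only [nbrSum]
              norm_num
              rw [z]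
              linarith [he4 (1, -1), he4 (0, 0), he4 (0, -2)]
            · simp only [nbrSum]
              norm_num
              rw [z]
              linarith [he4 (0, 0), he4 (-2, 0), he4 (-1, 1)]
          rw [srcB, if_pos hs]
          nlinarith
        · have : nbrSum e p ≤ 16 := by
            rw [nbrSum]
            linarith [he4 (p.1 + 1, p.2), he4 (p.1 - 1, p.2), he4 (p.1, p.2 + 1),
              he4 (p.1, p.2 - 1)]
          rw [srcB, if_neg hs]
          nlinarith
      have h3 : nbrSum (fun p => e p - u p) p = nbrSum e p - nbrSum u p := by
        simp only [nbrSum]; ring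
      have h4 : e p = 4 := indicator_of_mem hp _
      rw [h3, h4]
      linarith) p
  linarith [he4 p]

theorem IsGreen.src_le {t : ℝ} (ht0 : 0 < t) {src u : ℤ × ℤ → ℝ}
    (h : IsGreen t src u) (hu : ∀ p, 0 ≤ u p) {p : ℤ × ℤ} (hp : p ∈ coneC) : src p ≤ u p := by
  rw [h.eq p hp]
  have : 0 ≤ nbrSum u p := by
    rw [nbrSum]
    linarith [hu (p.1 + 1, p.2), hu (p.1 - 1, p.2), hu (p.1, p.2 + 1), hu (p.1, p.2 - 1)]
  nlinarith

/-- The Green function paired with the total-length generating function. -/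
theorem IsGreen.tsum_srcA {t : ℝ} (ht0 : 0 < t) (ht : t < 1 / 4) {u : ℤ × ℤ → ℝ}
    (h : IsGreen t srcA u) : ∑' p, u p = 3 * coneGF t (0, 0) + quadGF t (0, 0) := by
  have hs := hasSum_srcA (𝕜 := ℝ) (coneGF t)
  have := h.duality (χ := coneGF t) (M := (1 - 4 * t)⁻¹)
    (fun p => by
      rw [Real.norm_of_nonneg (coneGF_nonneg ht0 p)]
      exact coneGF_le ht0 ht p) (fun p hp => coneGF_off t hp) hs.summable
  have hs' := hs.tsum_eq
  simp only [RCLike.ofReal_real_eq_id, id_eq] at hs'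
  rw [hs'] at this
  rw [quadGF]
  have e : ∑' p, u p * (coneGF t p - t * nbrSum (coneGF t) p) = ∑' p, u p := by
    refine tsum_congr fun p => ?_
    by_cases hp : p ∈ coneC
    · rw [coneGF_eq ht0 ht hp]; ring
    · rw [h.off p hp, zero_mul]
  rw [← e, this]
  norm_num
  ring

theorem tsum_eq_tsum_nat {F : ℤ × ℤ → 𝕜} {φ : ℕ → ℤ × ℤ} (hφ : Function.Injective φ)
    (h : ∀ p, p ∉ range φ → F p = 0) : ∑' p, F p = ∑' n, F (φ n) :=
  (hφ.tsum_eq (Function.support_subset_iff'.mpr h)).symm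

/-- Lattice points on the negative vertical half axis. -/
def downAxis (n : ℕ) : ℤ × ℤ := (0, -1 - n)

/-- Lattice points on the negative horizontal half axis. -/
def leftAxis (n : ℕ) : ℤ × ℤ := (-1 - n, 0)

/-- Lattice points on the diagonal of the quadrant. -/
def diagPt (n : ℕ) : ℤ × ℤ := (n, n)

theorem downAxis_injective : Function.Injective downAxis := fun m n h => by
  simp only [downAxis, Prod.mk.injEq] at h; omega

theorem leftAxis_injective : Function.Injective leftAxis := fun m n h => by
  simp only [leftAxis, Prod.mk.injEq] at h; omega

theorem diagPt_injective : Function.Injective diagPt := fun m n h => by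
  simp only [diagPt, Prod.mk.injEq] at h; omega

theorem mem_range_downAxis {i j : ℤ} : (i, j) ∈ range downAxis ↔ i = 0 ∧ j < 0 := by
  constructor
  · rintro ⟨n, h⟩
    simp only [downAxis, Prod.mk.injEq] at h; omega
  · rintro ⟨rfl, hj⟩
    refine ⟨(-1 - j).toNat, ?_⟩
    simp only [downAxis, Prod.mk.injEq, true_and]; omega

theorem mem_range_leftAxis {i j : ℤ} : (i, j) ∈ range leftAxis ↔ j = 0 ∧ i < 0 := by
  constructor
  · rintro ⟨n, h⟩
    simp only [leftAxis, Prod.mk.injEq] at h; omega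
  · rintro ⟨rfl, hj⟩
    refine ⟨(-1 - i).toNat, ?_⟩
    simp only [leftAxis, Prod.mk.injEq, and_true]; omega

theorem mem_range_diagPt {i j : ℤ} : (i, j) ∈ range diagPt ↔ i = j ∧ 0 ≤ i := by
  constructor
  · rintro ⟨n, h⟩
    simp only [diagPt, Prod.mk.injEq] at h; omega
  · rintro ⟨rfl, hj⟩
    refine ⟨i.toNat, ?_⟩
    simp only [diagPt, Prod.mk.injEq]; omega

theorem IsGreen.summable_comp {t : 𝕜} {src u : ℤ × ℤ → 𝕜} (h : IsGreen t src u) {φ : ℕ → ℤ × ℤ}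
    (hφ : Function.Injective φ) : Summable fun n => ‖u (φ n)‖ :=
  h.summable.comp_injective hφ

/-- The mass balance between the source, the killing at the boundary and the total mass. -/
theorem IsGreen.tsum_balance {t : ℝ} {src u : ℤ × ℤ → ℝ} (h : IsGreen t src u)
    (hsym : ∀ p, u p.swap = u p) (hs : Summable src) (hoff : ∀ p ∉ coneC, src p = 0) :
    (1 - 4 * t) * ∑' p, u p + ∑' n, 2 * t * u (downAxis n) = ∑' p, src p := by
  have hind : ∀ p, src p * coneC.indicator (fun _ => (1 : ℝ)) p = src p := fun p => by
    by_cases hp : p ∈ coneC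
    · rw [indicator_of_mem hp, mul_one]
    · rw [indicator_of_notMem hp, hoff p hp, mul_zero]
  have hd := h.duality (χ := coneC.indicator fun _ => 1) (M := 1)
    (fun p => (norm_indicator_le_norm_self _ _).trans (by simp))
    (fun p hp => indicator_of_notMem hp _) (by simpa only [hind] using hs)
  simp only [hind] at hd
  rw [← hd]
  have s0 := h.summable.of_norm
  have s1 : Summable fun p => (range downAxis).indicator u p := s0.indicator _
  have s2 : Summable fun p => (range leftAxis).indicator u p := s0.indicator _
  have e : ∀ p, u p * (coneC.indicator (fun _ => (1 : ℝ)) p -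
      t * nbrSum (coneC.indicator fun _ => (1 : ℝ)) p) = (1 - 4 * t) * u p +
      (t * (range downAxis).indicator u p + t * (range leftAxis).indicator u p) := by
    rintro ⟨i, j⟩
    by_cases hp : (i, j) ∈ coneC
    · have c1 : ∀ i j : ℤ, 0 ≤ i ∨ 0 ≤ j → coneC.indicator (fun _ => (1 : ℝ)) (i, j) = 1 :=
        fun i j h => indicator_of_mem (mem_coneC.mpr h) _
      have c0 : ∀ i j : ℤ, ¬(0 ≤ i ∨ 0 ≤ j) → coneC.indicator (fun _ => (1 : ℝ)) (i, j) = 0 :=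
        fun i j h => indicator_of_notMem (mem_coneC.not.mpr h) _
      rw [mem_coneC] at hp
      simp only [nbrSum]
      by_cases h1 : i = 0 ∧ j < 0
      · rw [indicator_of_mem (mem_range_downAxis.mpr h1),
          indicator_of_notMem (mem_range_leftAxis.not.mpr (by omega)), c1 i j (by omega),
          c1 (i + 1) j (by omega), c0 (i - 1) j (by omega), c1 i (j + 1) (by omega),
          c1 i (j - 1) (by omega)]
        ring
      · rw [indicator_of_notMem (mem_range_downAxis.not.mpr h1)]
        by_cases h2 : j = 0 ∧ i < 0
        · rw [indicator_of_mem (mem_range_leftAxis.mpr h2), c1 i j (by omega),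
            c1 (i + 1) j (by omega), c1 (i - 1) j (by omega), c1 i (j + 1) (by omega),
            c0 i (j - 1) (by omega)]
          ring
        · rw [indicator_of_notMem (mem_range_leftAxis.not.mpr h2), c1 i j (by omega),
            c1 (i + 1) j (by omega), c1 (i - 1) j (by omega), c1 i (j + 1) (by omega),
            c1 i (j - 1) (by omega)]
          ring
    · have hz := h.off _ hp
      rw [hz]
      simp [indicator, hz]
  rw [tsum_congr e, (s0.mul_left _).tsum_add ((s1.mul_left t).add (s2.mul_left t)),
    (s1.mul_left t).tsum_add (s2.mul_left t), tsum_mul_left, tsum_mul_left, tsum_mul_left,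
    tsum_mul_left, tsum_eq_tsum_nat downAxis_injective fun p hp => indicator_of_notMem hp _,
    tsum_eq_tsum_nat leftAxis_injective fun p hp => indicator_of_notMem hp _]
  have e3 : ∀ n, (range leftAxis).indicator u (leftAxis n) =
      (range downAxis).indicator u (downAxis n) := fun n => by
    rw [indicator_of_mem (mem_range_self n), indicator_of_mem (mem_range_self n)]
    exact hsym (downAxis n)
  have e4 : ∀ n, (range downAxis).indicator u (downAxis n) = u (downAxis n) := fun n =>
    indicator_of_mem (mem_range_self n) _
  simp only [e3, e4]
  ring

end ConeSources

section ConeKernel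

open Set Filter Topology

/-- The bounded test function attached to a point of the kernel curve. -/
noncomputable def kerFun (X Y : ℂ) (p : ℤ × ℤ) : ℂ :=
  if 0 ≤ p.1 ∧ p.2 < p.1 then X ^ (p.1 - p.2) * Y ^ p.1
  else if p.1 = p.2 ∧ 0 ≤ p.1 then 2⁻¹ * Y ^ p.1 else 0

/-- The defect of `kerFun` on the negative vertical half axis. -/
noncomputable def kerLine (t : ℝ) (X Y : ℂ) (p : ℤ × ℤ) : ℂ :=
  if p.1 = 0 ∧ p.2 < 0 then t * X ^ (-1 - p.2) * Y⁻¹ else 0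

/-- The defect of `kerFun` on the diagonal. -/
noncomputable def kerDiag (t : ℝ) (X Y : ℂ) (p : ℤ × ℤ) : ℂ :=
  if p.1 = p.2 ∧ 0 ≤ p.1 then Y ^ p.1 * (2⁻¹ - t * (X + X * Y)) else 0

/-- Half of the swap-antisymmetric defect of `kerFun` next to the diagonal. -/
noncomputable def kerOff (Y : ℂ) (p : ℤ × ℤ) : ℂ :=
  if p.2 = p.1 - 1 ∧ 0 ≤ p.1 then Y ^ p.1 + (if 1 ≤ p.1 then Y ^ (p.1 - 1) else 0) else 0

theorem kerFun_low {X Y : ℂ} {i j : ℤ} (hi : 0 ≤ i) (hj : j < i) :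
    kerFun X Y (i, j) = X ^ (i - j) * Y ^ i := if_pos ⟨hi, hj⟩

theorem kerFun_diag {X Y : ℂ} {i j : ℤ} (hi : 0 ≤ i) (hj : i = j) :
    kerFun X Y (i, j) = 2⁻¹ * Y ^ i := by
  rw [kerFun, if_neg (by simp only; omega), if_pos ⟨hj, hi⟩]

theorem kerFun_zero {X Y : ℂ} {i j : ℤ} (h : i < 0 ∨ i < j) : kerFun X Y (i, j) = 0 := by
  rw [kerFun, if_neg (by simp only; omega), if_neg (by simp only; omega)]

theorem kerFun_defect {t : ℝ} {X Y : ℂ} (hX : X ≠ 0) (hY : Y ≠ 0)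
    (hc : t * (1 + Y) * (1 + X ^ 2 * Y) = X * Y) {p : ℤ × ℤ} (hp : p ∈ coneC) :
    kerFun X Y p - t * nbrSum (kerFun X Y) p =
      kerLine t X Y p + kerDiag t X Y p + t * 2⁻¹ * (kerOff Y p - kerOff Y p.swap) := by
  obtain ⟨i, j⟩ := p
  rw [mem_coneC] at hp
  simp only [nbrSum, kerLine, kerDiag, kerOff, Prod.swap]
  rcases lt_trichotomy i j with hij | rfl | hij
  · by_cases h1 : j = i + 1
    · subst h1
      rw [kerFun_zero (by omega), kerFun_diag (by omega) (by omega), kerFun_zero (by omega),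
        kerFun_zero (by omega), if_neg (by omega), if_neg (by omega), if_neg (by omega),
        if_pos (by omega)]
      by_cases h2 : 0 ≤ i
      · rw [kerFun_diag h2 (by omega), if_pos (by omega), add_sub_cancel_right]
        ring
      · rw [kerFun_zero (by omega), if_neg (by omega)]
        ring
    · rw [kerFun_zero (by omega), kerFun_zero (by omega), kerFun_zero (by omega),
        kerFun_zero (by omega), kerFun_zero (by omega), if_neg (by omega), if_neg (by omega),
        if_neg (by omega), if_neg (by omega)]
      ring
  · have hi : 0 ≤ i := by omega
    rw [kerFun_diag hi rfl, kerFun_low (by omega) (by omega), kerFun_zero (by omega),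
      kerFun_zero (by omega), kerFun_low (by omega) (by omega), if_neg (by omega),
      if_pos (by omega), if_neg (by omega)]
    have e1 : i + 1 - i = 1 := by ring
    have e2 : i - (i - 1) = 1 := by ring
    rw [e1, e2, zpow_one, zpow_add_one₀ hY]
    ring
  · have hi : 0 ≤ i := by omega
    rw [kerFun_low hi hij, kerFun_low (by omega : 0 ≤ i + 1) (by omega),
      kerFun_low hi (by omega : j - 1 < i)]
    have e1 : X ^ (i + 1 - j) = X ^ (i - j) * X := by
      rw [← zpow_add_one₀ hX]; congr 1; ring
    have e2 : X ^ (i - (j - 1)) = X ^ (i - j) * X := by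
      rw [← zpow_add_one₀ hX]; congr 1; ring
    have e3 : X ^ (i - 1 - j) = X ^ (i - j) * X⁻¹ := by
      rw [← zpow_sub_one₀ hX]; congr 1; ring
    have e4 : X ^ (i - (j + 1)) = X ^ (i - j) * X⁻¹ := by
      rw [← zpow_sub_one₀ hX]; congr 1; ring
    rw [e1, e2, zpow_add_one₀ hY]
    by_cases h1 : j = i - 1
    · subst h1
      rw [kerFun_diag hi (by omega : i = i - 1 + 1)]
      have e5 : i - (i - 1) = 1 := by ring
      rw [e5, zpow_one, if_neg (by omega : ¬(i = i - 1 ∧ 0 ≤ i)),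
        if_pos (by omega : i - 1 = i - 1 ∧ 0 ≤ i),
        if_neg (by omega : ¬(i = i - 1 - 1 ∧ 0 ≤ i - 1))]
      by_cases h2 : 1 ≤ i
      · rw [kerFun_diag (by omega) rfl, if_neg (by omega), if_pos h2, zpow_sub_one₀ hY]
        field_simp
        linear_combination (-2 * Y ^ i) * hc
      · obtain rfl : i = 0 := by omega
        rw [kerFun_zero (by omega), if_pos (by omega), if_neg h2]
        simp only [zpow_zero, zero_sub, sub_neg_eq_add, neg_add_cancel]
        field_simp
        linear_combination (-2) * hc
    · rw [kerFun_low hi (by omega : j + 1 < i), e4, if_neg (by omega : ¬(i = j ∧ 0 ≤ i)),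
        if_neg (by omega : ¬(j = i - 1 ∧ 0 ≤ i)), if_neg (by omega : ¬(i = j - 1 ∧ 0 ≤ j))]
      by_cases h2 : i = 0
      · subst h2
        have e5 : X ^ (-1 - j) = X ^ (0 - j) * X⁻¹ := by
          rw [← zpow_sub_one₀ hX]; congr 1; ring
        rw [kerFun_zero (by omega), if_pos (by omega), e5]
        simp only [zpow_zero]
        field_simp
        linear_combination (-2 * X ^ (0 - j)) * hc
      · rw [kerFun_low (by omega) (by omega), e3, zpow_sub_one₀ hY, if_neg (by omega)]
        field_simp
        linear_combination (-2 * X ^ (i - j) * Y ^ i) * hc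

theorem norm_zpow_le_one {z : ℂ} (hz : ‖z‖ ≤ 1) {k : ℤ} (hk : 0 ≤ k) : ‖z ^ k‖ ≤ 1 := by
  obtain ⟨n, rfl⟩ := Int.eq_ofNat_of_zero_le hk
  rw [zpow_natCast, norm_pow]
  exact pow_le_one₀ (norm_nonneg _) hz

theorem norm_kerFun_le {X Y : ℂ} (hX : ‖X‖ ≤ 1) (hY : ‖Y‖ ≤ 1) (p : ℤ × ℤ) :
    ‖kerFun X Y p‖ ≤ 1 := by
  rw [kerFun]
  split_ifs with h1 h2
  · rw [norm_mul]
    exact mul_le_one₀ (norm_zpow_le_one hX (by omega)) (norm_nonneg _) (norm_zpow_le_one hY h1.1)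
  · rw [norm_mul]
    refine mul_le_one₀ ?_ (norm_nonneg _) (norm_zpow_le_one hY h2.2)
    norm_num
  · simp

theorem norm_kerOff_le {Y : ℂ} (hY : ‖Y‖ ≤ 1) (p : ℤ × ℤ) : ‖kerOff Y p‖ ≤ 2 := by
  rw [kerOff]
  split_ifs with h1 h2
  · refine (norm_add_le _ _).trans ?_
    linarith [norm_zpow_le_one hY h1.2, norm_zpow_le_one hY (by omega : 0 ≤ p.1 - 1)]
  · rw [add_zero]
    linarith [norm_zpow_le_one hY h1.2]
  · simp

theorem IsGreen.kernel_identity {t : ℝ} {src u : ℤ × ℤ → ℝ} (h : IsGreen t src u)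
    (hsym : ∀ p, u p.swap = u p) {X Y S : ℂ} (hX : X ≠ 0) (hY : Y ≠ 0) (hX1 : ‖X‖ ≤ 1)
    (hY1 : ‖Y‖ ≤ 1) (hc : t * (1 + Y) * (1 + X ^ 2 * Y) = X * Y)
    (hS : HasSum (fun p => (src p : ℂ) * kerFun X Y p) S) :
    ∑' n, ((2 * t * u (downAxis n) : ℝ) : ℂ) * X ^ n =
      2 * Y * S + Y * (2 * t * X * (1 + Y) - 1) * ∑' n, ((u (diagPt n) : ℝ) : ℂ) * Y ^ n := by
  have hg := h.ofReal
  have hd := hg.duality (norm_kerFun_le hX1 hY1) (fun p hp => kerFun_zero (by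
    have : ¬(0 ≤ p.1 ∨ 0 ≤ p.2) := hp
    omega)) hS.summable
  rw [hS.tsum_eq] at hd
  set U : ℤ × ℤ → ℂ := fun p => (u p : ℂ) with hU
  have sU : Summable fun p => ‖U p‖ := hg.summable
  have hline : ∀ p, p ∉ range downAxis → U p * kerLine t X Y p = 0 := by
    rintro ⟨i, j⟩ hp
    rw [mem_range_downAxis] at hp
    rw [kerLine, if_neg hp, mul_zero]
  have hdiag : ∀ p, p ∉ range diagPt → U p * kerDiag t X Y p = 0 := by
    rintro ⟨i, j⟩ hp
    rw [mem_range_diagPt] at hp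
    rw [kerDiag, if_neg hp, mul_zero]
  have vline : ∀ n, U (downAxis n) * kerLine t X Y (downAxis n) =
      (2 * Y)⁻¹ * (((2 * t * u (downAxis n) : ℝ) : ℂ) * X ^ n) := fun n => by
    have e : (-1 - (-1 - (n : ℤ))) = n := by ring
    have e' : kerLine t X Y (downAxis n) = t * X ^ (-1 - (-1 - (n : ℤ))) * Y⁻¹ :=
      if_pos ⟨rfl, by simp only [downAxis]; omega⟩
    rw [e', e, zpow_natCast]
    simp only [hU]
    push_cast
    field_simp
  have vdiag : ∀ n, U (diagPt n) * kerDiag t X Y (diagPt n) =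
      (2⁻¹ - t * (X + X * Y)) * (((u (diagPt n) : ℝ) : ℂ) * Y ^ n) := fun n => by
    have e' : kerDiag t X Y (diagPt n) = Y ^ (n : ℤ) * (2⁻¹ - t * (X + X * Y)) :=
      if_pos ⟨rfl, Int.natCast_nonneg n⟩
    rw [e', zpow_natCast]
    simp only [hU]
    ring
  have sline : Summable fun p => U p * kerLine t X Y p := by
    rw [← downAxis_injective.summable_iff hline]
    change Summable fun n => U (downAxis n) * kerLine t X Y (downAxis n)
    simp only [vline]
    refine Summable.mul_left _ (Summable.of_norm_bounded
      ((hg.summable_comp downAxis_injective).mul_left ‖(2 * t : ℂ)‖) fun n => ?_)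
    push_cast
    rw [norm_mul, norm_mul, norm_pow]
    exact mul_le_of_le_one_right (by positivity) (pow_le_one₀ (norm_nonneg _) hX1)
  have sdiag : Summable fun p => U p * kerDiag t X Y p := by
    rw [← diagPt_injective.summable_iff hdiag]
    change Summable fun n => U (diagPt n) * kerDiag t X Y (diagPt n)
    simp only [vdiag]
    refine Summable.mul_left _ (Summable.of_norm_bounded
      (hg.summable_comp diagPt_injective) fun n => ?_)
    rw [norm_mul, norm_pow]
    exact mul_le_of_le_one_right (by positivity) (pow_le_one₀ (norm_nonneg _) hY1)
  have soff : Summable fun p => U p * kerOff Y p :=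
    (summable_norm_mul_bounded sU (norm_kerOff_le hY1)).of_norm
  have soff' : Summable fun p : ℤ × ℤ => U p * kerOff Y p.swap :=
    (summable_norm_mul_bounded sU fun p => norm_kerOff_le hY1 p.swap).of_norm
  have hoff : ∑' p : ℤ × ℤ, U p * kerOff Y p.swap = ∑' p, U p * kerOff Y p := by
    rw [← (Equiv.prodComm ℤ ℤ).tsum_eq fun p => U p * kerOff Y p]
    refine tsum_congr fun p => ?_
    simp only [Equiv.prodComm_apply, hU, hsym]
  have split : ∀ p, U p * (kerFun X Y p - t * nbrSum (kerFun X Y) p) =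
      (U p * kerLine t X Y p + U p * kerDiag t X Y p) +
        t * 2⁻¹ * (U p * kerOff Y p - U p * kerOff Y p.swap) := fun p => by
    by_cases hp : p ∈ coneC
    · rw [kerFun_defect hX hY hc hp]; ring
    · have : U p = 0 := hg.off p hp
      rw [this]; ring
  rw [tsum_congr split, (sline.add sdiag).tsum_add ((soff.sub soff').mul_left _),
    sline.tsum_add sdiag, tsum_mul_left, soff.tsum_sub soff', hoff, sub_self, mul_zero, add_zero,
    tsum_eq_tsum_nat downAxis_injective hline, tsum_eq_tsum_nat diagPt_injective hdiag,
    tsum_congr vline, tsum_congr vdiag, tsum_mul_left, tsum_mul_left] at hd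
  rw [← hd]
  field_simp
  ring

/-- The series data extracted from the two Green functions at a fixed value of `t`. -/
structure ConeData (t : ℝ) where
  (b dB a dA : ℕ → ℝ)
  (massB massA q : ℝ)
  b_nonneg : ∀ n, 0 ≤ b n
  dB_nonneg : ∀ n, 0 ≤ dB n
  dB_le : ∀ n, dB n ≤ 4
  b_summable : Summable b
  dB_summable : Summable dB
  a_summable : Summable a
  dA_summable : Summable dA
  massB_pos : 0 < massB
  massA_nonneg : 0 ≤ massA
  balanceB : (1 - 4 * t) * massB + ∑' n, b n = 2
  balanceA : (1 - 4 * t) * massA + ∑' n, a n = 4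
  massA_eq : massA = 3 * coneGF t (0, 0) + q
  q_nonneg : 0 ≤ q
  q_le : q ≤ 2 / Real.sqrt (1 - 4 * t)
  kernelB : ∀ X Y : ℂ, X ≠ 0 → Y ≠ 0 → ‖X‖ ≤ 1 → ‖Y‖ ≤ 1 →
    t * (1 + Y) * (1 + X ^ 2 * Y) = X * Y →
    ∑' n, (b n : ℂ) * X ^ n =
      2 * X * Y + Y * (2 * t * X * (1 + Y) - 1) * ∑' n, (dB n : ℂ) * Y ^ n
  kernelA : ∀ X Y : ℂ, X ≠ 0 → Y ≠ 0 → ‖X‖ ≤ 1 → ‖Y‖ ≤ 1 →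
    t * (1 + Y) * (1 + X ^ 2 * Y) = X * Y →
    ∑' n, (a n : ℂ) * X ^ n =
      2 * Y * (1 + X ^ 2) + Y * (2 * t * X * (1 + Y) - 1) * ∑' n, (dA n : ℂ) * Y ^ n

theorem nonempty_coneData {t : ℝ} (ht0 : 0 < t) (ht : t < 1 / 4) : Nonempty (ConeData t) := by
  obtain ⟨u, hu, hu0, husym⟩ := exists_isGreen ht0 ht srcB_nonneg summable_srcB
    (fun p hp => srcB_off hp) srcB_swap
  obtain ⟨v, hv, hv0, hvsym⟩ := exists_isGreen ht0 ht srcA_nonneg summable_srcA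
    (fun p hp => srcA_off hp) srcA_swap
  have hB := hu.tsum_balance husym summable_srcB fun p hp => srcB_off hp
  have hA := hv.tsum_balance hvsym summable_srcA fun p hp => srcA_off hp
  have eB : ∑' p, srcB p = 2 := by
    have := (hasSum_srcB (𝕜 := ℝ) fun _ => 1).tsum_eq
    simp only [RCLike.ofReal_real_eq_id, id_eq, mul_one] at this
    rw [this]; norm_num
  have eA : ∑' p, srcA p = 4 := by
    have := (hasSum_srcA (𝕜 := ℝ) fun _ => 1).tsum_eq
    simp only [RCLike.ofReal_real_eq_id, id_eq, mul_one] at this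
    rw [this]; norm_num
  rw [eB] at hB
  rw [eA] at hA
  have hmem : ((0 : ℤ), (-1 : ℤ)) ∈ coneC := mem_coneC.mpr (Or.inl le_rfl)
  exact ⟨{
    b := fun n => 2 * t * u (downAxis n)
    dB := fun n => u (diagPt n)
    a := fun n => 2 * t * v (downAxis n)
    dA := fun n => v (diagPt n)
    massB := ∑' p, u p
    massA := ∑' p, v p
    q := quadGF t (0, 0)
    b_nonneg := fun n => mul_nonneg (by positivity) (hu0 _)
    dB_nonneg := fun n => hu0 _
    dB_le := fun n => hu.srcB_le ht0 ht _
    b_summable := (hu.summable_comp downAxis_injective).of_norm.mul_left _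
    dB_summable := (hu.summable_comp diagPt_injective).of_norm
    a_summable := (hv.summable_comp downAxis_injective).of_norm.mul_left _
    dA_summable := (hv.summable_comp diagPt_injective).of_norm
    massB_pos := by
      have h1 : srcB (0, -1) = 1 := by simp [srcB]
      have h2 := hu.src_le ht0 hu0 hmem
      have h3 := hu.summable.of_norm.le_tsum (0, -1) fun q _ => hu0 q
      linarith
    massA_nonneg := tsum_nonneg hv0
    balanceB := hB
    balanceA := hA
    massA_eq := hv.tsum_srcA ht0 ht
    q_nonneg := quadGF_nonneg ht0 ht
    q_le := quadGF_zero_le ht0 ht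
    kernelB := fun X Y hX hY hX1 hY1 hc => by
      rw [hu.kernel_identity husym hX hY hX1 hY1 hc (hasSum_srcB (𝕜 := ℂ) (kerFun X Y)),
        kerFun_low le_rfl (by norm_num), kerFun_zero (by norm_num)]
      norm_num
      ring
    kernelA := fun X Y hX hY hX1 hY1 hc => by
      rw [hv.kernel_identity hvsym hX hY hX1 hY1 hc (hasSum_srcA (𝕜 := ℂ) (kerFun X Y)),
        kerFun_diag le_rfl rfl, kerFun_zero (by norm_num), kerFun_low le_rfl (by norm_num)]
      norm_num }⟩

end ConeKernel

section Invariants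

open Set Filter Topology Metric

theorem continuousOn_cseries {a : ℕ → ℝ} (ha : Summable a) :
    ContinuousOn (fun z : ℂ => ∑' n, (a n : ℂ) * z ^ n) (closedBall 0 1) := by
  refine continuousOn_tsum (fun i => by fun_prop) ha.norm fun n z hz => ?_
  rw [mem_closedBall_zero_iff] at hz
  rw [norm_mul, norm_pow, Complex.norm_real]
  exact mul_le_of_le_one_right (norm_nonneg _) (pow_le_one₀ (norm_nonneg _) hz)

theorem differentiableOn_cseries {a : ℕ → ℝ} (ha : Summable a) :
    DifferentiableOn ℂ (fun z : ℂ => ∑' n, (a n : ℂ) * z ^ n) (ball 0 1) := by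
  refine Complex.differentiableOn_tsum_of_summable_norm ha.norm (fun i => by fun_prop) isOpen_ball
    fun n z hz => ?_
  rw [mem_ball_zero_iff] at hz
  rw [norm_mul, norm_pow, Complex.norm_real]
  exact mul_le_of_le_one_right (norm_nonneg _) (pow_le_one₀ (norm_nonneg _) hz.le)

theorem summable_series {a : ℕ → ℝ} (ha : Summable a) {x : ℝ} (hx : |x| ≤ 1) :
    Summable fun n => a n * x ^ n := by
  refine Summable.of_norm_bounded ha.norm fun n => ?_
  rw [norm_mul, norm_pow, Real.norm_eq_abs x]
  exact mul_le_of_le_one_right (norm_nonneg _) (pow_le_one₀ (abs_nonneg _) hx)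

theorem cseries_split {a : ℕ → ℝ} (ha : Summable a) {z : ℂ} (hz : ‖z‖ ≤ 1) :
    ∑' n, (a n : ℂ) * z ^ n = a 0 + a 1 * z + z ^ 2 * ∑' n, (a (n + 2) : ℂ) * z ^ n := by
  have hs : Summable fun n => (a n : ℂ) * z ^ n := by
    refine Summable.of_norm_bounded ha.norm fun n => ?_
    rw [norm_mul, norm_pow, Complex.norm_real]
    exact mul_le_of_le_one_right (norm_nonneg _) (pow_le_one₀ (norm_nonneg _) hz)
  rw [← hs.sum_add_tsum_nat_add 2, Finset.sum_range_succ, Finset.sum_range_one, ← tsum_mul_left]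
  congr 1
  · simp
  · exact tsum_congr fun n => by ring

/-- Every point of the unit circle lifts to the kernel curve, with a small second coordinate. -/
theorem exists_curve_of_norm_eq_one {t ρ : ℝ} (ht : 0 < t) (hρ0 : 0 < ρ)
    (hρ : t * (1 + ρ) ^ 2 < ρ) {X : ℂ} (hX : ‖X‖ = 1) :
    ∃ Y : ℂ, Y ≠ 0 ∧ ‖Y‖ < ρ ∧ t * (1 + Y) * (1 + X ^ 2 * Y) = X * Y := by
  set r := X.re with hr
  have hr1 : r ≤ 1 := (le_abs_self _).trans ((Complex.abs_re_le_norm X).trans hX.le)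
  have hconj : X * (starRingEnd ℂ) X = 1 := by
    rw [Complex.mul_conj, Complex.normSq_eq_norm_sq, hX]; norm_num
  have hadd : X + (starRingEnd ℂ) X = ((2 * r : ℝ) : ℂ) := by
    rw [Complex.add_conj]
  obtain ⟨Z, ⟨hZ0, hZρ⟩, hZ⟩ : ∃ Z ∈ Ioo 0 ρ, Z - t * (Z ^ 2 + 2 * r * Z + 1) = 0 := by
    refine intermediate_value_Ioo hρ0.le (f := fun Z => Z - t * (Z ^ 2 + 2 * r * Z + 1))
      (by fun_prop) ⟨by simpa using ht, ?_⟩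
    have : t * (ρ * r) ≤ t * (ρ * 1) := by gcongr
    change 0 < ρ - t * (ρ ^ 2 + 2 * r * ρ + 1)
    nlinarith
  have hZ' : (Z : ℂ) - t * (Z ^ 2 + ((2 * r : ℝ) : ℂ) * Z + 1) = 0 := by exact_mod_cast hZ
  rw [← hadd] at hZ'
  refine ⟨Z * (starRingEnd ℂ) X, ?_, ?_, ?_⟩
  · refine mul_ne_zero (by exact_mod_cast hZ0.ne') fun h => ?_
    rw [h, mul_zero] at hconj
    exact zero_ne_one hconj
  · rw [norm_mul, Complex.norm_conj, hX, mul_one, Complex.norm_real, Real.norm_eq_abs,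
      abs_of_pos hZ0]
    exact hZρ
  · linear_combination -hZ' + (t * Z * (X + (Z : ℂ) * (starRingEnd ℂ) X * X + Z) - Z) * hconj

/-- Every point of a suitable circle in the second coordinate lifts to the kernel curve, with first
coordinate inside the unit disc. -/
theorem exists_curve_of_norm_eq {t ρ : ℝ} (ht : 0 < t) (hρ0 : 0 < ρ) (hρ1 : ρ < 1)
    (hρ : t * (1 + ρ) ^ 2 < ρ) {Y : ℂ} (hY : ‖Y‖ = ρ) :
    ∃ X : ℂ, X ≠ 0 ∧ ‖X‖ < 1 ∧ t * (1 + Y) * (1 + X ^ 2 * Y) = X * Y := by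
  have hY0 : Y ≠ 0 := fun h => by rw [h, norm_zero] at hY; exact hρ0.ne hY
  have hY1 : 1 + Y ≠ 0 := fun h => by
    have : Y = -1 := by linear_combination h
    rw [this, norm_neg, norm_one] at hY
    exact hρ1.ne hY.symm
  have ht' : (t : ℂ) ≠ 0 := by exact_mod_cast ht.ne'
  obtain ⟨w, hw⟩ := IsAlgClosed.exists_pow_nat_eq
    (Y ^ 2 - 4 * (t * (1 + Y)) ^ 2 * Y) (n := 2) (by norm_num)
  set A := t * (1 + Y) with hA
  have hA0 : A ≠ 0 := mul_ne_zero ht' hY1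
  set X₁ := (Y + w) / (2 * A * Y) with hX₁
  set X₂ := (Y - w) / (2 * A * Y) with hX₂
  have e1 : A * (1 + X₁ ^ 2 * Y) = X₁ * Y := by
    rw [hX₁]; field_simp; linear_combination hw
  have e2 : A * (1 + X₂ ^ 2 * Y) = X₂ * Y := by
    rw [hX₂]; field_simp; linear_combination hw
  have ne : ∀ X : ℂ, A * (1 + X ^ 2 * Y) = X * Y → X ≠ 0 := fun X h h0 => by
    rw [h0] at h; apply hA0; linear_combination h
  by_contra hcon
  push Not at hcon
  have n1 : 1 ≤ ‖X₁‖ := not_lt.mp fun h => hcon X₁ (ne _ e1) h e1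
  have n2 : 1 ≤ ‖X₂‖ := not_lt.mp fun h => hcon X₂ (ne _ e2) h e2
  have hsum : (X₁ + X₂) * A = 1 := by rw [hX₁, hX₂]; field_simp; ring
  have hprod : X₁ * X₂ * Y = 1 := by
    rw [hX₁, hX₂]; field_simp; linear_combination -hw
  have nsum := congrArg norm hsum
  have nprod := congrArg norm hprod
  rw [norm_mul, norm_one] at nsum
  rw [norm_mul, norm_mul, norm_one, hY] at nprod
  have nA : ‖A‖ ≤ t * (1 + ρ) := by
    rw [hA, norm_mul, Complex.norm_real, Real.norm_eq_abs, abs_of_pos ht]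
    gcongr
    exact (norm_add_le _ _).trans (by rw [norm_one, hY])
  have nadd : ‖X₁ + X₂‖ ≤ 1 + ‖X₁‖ * ‖X₂‖ :=
    (norm_add_le _ _).trans (by nlinarith)
  have h1 : 1 ≤ (1 + ‖X₁‖ * ‖X₂‖) * (t * (1 + ρ)) := by
    calc 1 = ‖X₁ + X₂‖ * ‖A‖ := nsum.symm
      _ ≤ _ := by gcongr
  have h2 : ρ * 1 ≤ ρ * ((1 + ‖X₁‖ * ‖X₂‖) * (t * (1 + ρ))) := by gcongr
  have h3 : ρ * ((1 + ‖X₁‖ * ‖X₂‖) * (t * (1 + ρ))) = t * (1 + ρ) ^ 2 := by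
    linear_combination t * (1 + ρ) * nprod
  linarith

/-- A pair of analytic functions that agree along the kernel curve is constant. -/
theorem eq_const_of_invariant {t ρ : ℝ} (ht : 0 < t) (hρ0 : 0 < ρ) (hρ1 : ρ < 1)
    (hρ : t * (1 + ρ) ^ 2 < ρ) {H L : ℂ → ℂ} (hHd : DifferentiableOn ℂ H (ball 0 1))
    (hHc : ContinuousOn H (closedBall 0 1)) (hL : DifferentiableOn ℂ L (ball 0 1))
    (h : ∀ X Y : ℂ, X ≠ 0 → Y ≠ 0 → ‖X‖ ≤ 1 → ‖Y‖ ≤ ρ →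
      t * (1 + Y) * (1 + X ^ 2 * Y) = X * Y → H X = L Y)
    {X Y : ℂ} (hX : ‖X‖ ≤ 1) (hY : ‖Y‖ ≤ ρ) : H X = L Y := by
  have hH : DiffContOnCl ℂ H (ball 0 1) := .mk_ball hHd hHc
  have hL' : DiffContOnCl ℂ L (ball 0 ρ) :=
    hL.diffContOnCl_ball (closedBall_subset_ball hρ1)
  obtain ⟨z, hz, hzmax⟩ := Complex.exists_mem_frontier_isMaxOn_norm isBounded_ball
    (nonempty_ball.mpr one_pos) hH
  obtain ⟨w, hw, hwmax⟩ := Complex.exists_mem_frontier_isMaxOn_norm isBounded_ball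
    (nonempty_ball.mpr hρ0) hL'
  rw [frontier_ball _ one_ne_zero, mem_sphere_zero_iff_norm] at hz
  rw [frontier_ball _ hρ0.ne', mem_sphere_zero_iff_norm] at hw
  rw [closure_ball _ one_ne_zero] at hzmax
  rw [closure_ball _ hρ0.ne'] at hwmax
  obtain ⟨Y₀, hY₀, hY₀ρ, hzY⟩ := exists_curve_of_norm_eq_one ht hρ0 hρ hz
  obtain ⟨X₀, hX₀, hX₀1, hXw⟩ := exists_curve_of_norm_eq ht hρ0 hρ1 hρ hw
  have ez := h z Y₀ (fun h => by simp [h] at hz) hY₀ hz.le hY₀ρ.le hzY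
  have ew := h X₀ w hX₀ (fun h => by simp [h, hρ0.ne] at hw) hX₀1.le hw.le hXw
  have l1 : ‖L Y₀‖ ≤ ‖L w‖ := hwmax (mem_closedBall_zero_iff.mpr hY₀ρ.le)
  have l2 : ‖H X₀‖ ≤ ‖H z‖ := hzmax (mem_closedBall_zero_iff.mpr hX₀1.le)
  have mX : IsMaxOn (norm ∘ H) (ball 0 1) X₀ := fun x hx =>
    le_trans (hzmax (ball_subset_closedBall hx)) (show ‖H z‖ ≤ ‖H X₀‖ by rw [ez, ew]; exact l1)
  have mY : IsMaxOn (norm ∘ L) (ball 0 ρ) Y₀ := fun x hx =>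
    le_trans (hwmax (ball_subset_closedBall hx))
      (show ‖L w‖ ≤ ‖L Y₀‖ by rw [← ez, ← ew]; exact l2)
  have cH := Complex.eqOn_closure_of_isPreconnected_of_isMaxOn_norm
    (convex_ball _ _).isPreconnected isOpen_ball hH (mem_ball_zero_iff.mpr hX₀1) mX
  have cL := Complex.eqOn_closure_of_isPreconnected_of_isMaxOn_norm
    (convex_ball _ _).isPreconnected isOpen_ball hL' (mem_ball_zero_iff.mpr hY₀ρ) mY
  rw [closure_ball _ one_ne_zero] at cH
  rw [closure_ball _ hρ0.ne'] at cL
  have a1 := cH (mem_closedBall_zero_iff.mpr hX)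
  have a2 := cH (mem_closedBall_zero_iff.mpr hz.le)
  have a3 := cL (mem_closedBall_zero_iff.mpr hY)
  simp only [Function.const] at a1 a2 a3
  rw [a1, ← a2, ez, a3]

theorem curve_factor {τ X Y : ℂ} (hτ : τ ≠ 0) (hX : X ≠ 0) (hY : Y ≠ 0) (hY1 : 1 + Y ≠ 0)
    (hc : τ * (1 + Y) * (1 + X ^ 2 * Y) = X * Y) :
    2 * X * Y - 2 / X = (2 * τ * X * (1 + Y) - 1) * Y * (2 / (τ * (1 + Y))) ∧
    2 * X + 2 / X - 1 / τ = (2 * τ * X * (1 + Y) - 1) * (2 * ((1 - Y) / (2 * τ * (1 + Y)))) ∧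
    2 / X ^ 2 - 2 / (τ * X) + 2 + 2 * Y * (1 + X ^ 2) =
      (2 * τ * X * (1 + Y) - 1) * Y * (2 / (τ ^ 2 * (1 + Y) ^ 2)) ∧
    (2 * τ * X * (1 + Y) - 1) ^ 2 * Y = Y - 4 * τ ^ 2 * (1 + Y) ^ 2 := by
  have hXY : 1 + X ^ 2 * Y ≠ 0 := fun h => by
    rw [h, mul_zero] at hc
    exact mul_ne_zero hX hY hc.symm
  have e : τ = X * Y / ((1 + Y) * (1 + X ^ 2 * Y)) := by
    field_simp; linear_combination hc
  subst e
  refine ⟨?_, ?_, ?_, ?_⟩ <;> field_simp <;> ring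

theorem curve_invariants {τ X Y a b D E : ℂ} (hτ : τ ≠ 0) (hX : X ≠ 0) (hY : Y ≠ 0)
    (hY1 : 1 + Y ≠ 0) (hc : τ * (1 + Y) * (1 + X ^ 2 * Y) = X * Y)
    (hb : b = 2 * X * Y + Y * (2 * τ * X * (1 + Y) - 1) * D)
    (ha : a = 2 * Y * (1 + X ^ 2) + Y * (2 * τ * X * (1 + Y) - 1) * E) :
    (b - 2 / X) ^ 2 = (Y - 4 * τ ^ 2 * (1 + Y) ^ 2) * (Y * (D + 2 / (τ * (1 + Y))) ^ 2) ∧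
    (b - 2 / X) * (b - 1 / τ + 2 * X) = (Y - 4 * τ ^ 2 * (1 + Y) ^ 2) *
      ((D + 2 / (τ * (1 + Y))) *
        (Y * (D + 2 / (τ * (1 + Y))) + 2 * ((1 - Y) / (2 * τ * (1 + Y))))) ∧
    (2 / X ^ 2 - 2 / (τ * X) + 2 + a) * (b - 1 / τ + 2 * X) =
      (Y - 4 * τ ^ 2 * (1 + Y) ^ 2) * ((E + 2 / (τ ^ 2 * (1 + Y) ^ 2)) *
        (Y * (D + 2 / (τ * (1 + Y))) + 2 * ((1 - Y) / (2 * τ * (1 + Y))))) := by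
  obtain ⟨h1, h2, h3, h4⟩ := curve_factor hτ hX hY hY1 hc
  set Δ := 2 * τ * X * (1 + Y) - 1
  set D' := D + 2 / (τ * (1 + Y)) with hD'
  set E' := E + 2 / (τ ^ 2 * (1 + Y) ^ 2) with hE'
  set M := (1 - Y) / (2 * τ * (1 + Y))
  have eσ : b - 2 / X = Δ * Y * D' := by rw [hb, hD']; linear_combination h1
  have ey : b - 1 / τ + 2 * X = Δ * (Y * D' + 2 * M) := by linear_combination eσ + h2
  have eS : 2 / X ^ 2 - 2 / (τ * X) + 2 + a = Δ * Y * E' := by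
    rw [ha, hE']; linear_combination h3
  rw [← h4, ey, eσ, eS]
  refine ⟨?_, ?_, ?_⟩ <;> ring

/-- The two algebraic relations satisfied by the boundary series, on the complex disc. -/
theorem ConeData.complex_relations {t : ℝ} (d : ConeData t) (ht0 : 0 < t) (ht : t < 1 / 4)
    {X : ℂ} (hX : X ≠ 0) (hX1 : ‖X‖ ≤ 1) {a b c m σ y v S : ℂ}
    (ea : a = ∑' n, (d.a n : ℂ) * X ^ n) (eb : b = ∑' n, (d.b n : ℂ) * X ^ n)
    (hcdef : c = 1 / t - d.b 0) (hm : m = 4 + 2 * d.b 1) (hσ : σ = b - 2 / X)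
    (hy : y = b - 1 / t + 2 * X) (hv : v = σ * y) (hS : S = 2 / X ^ 2 - 2 / (t * X) + 2 + a) :
    v ^ 2 - c ^ 2 * σ ^ 2 + 2 * m * v = 0 ∧
    2 * c * (S * y) + v ^ 2 - (2 * c ^ 2 - m) * v = 0 := by
  have htC : (t : ℂ) ≠ 0 := by exact_mod_cast ht0.ne'
  set ρ := (1 + 4 * t) / 2 with hρdef
  have hρ0 : 0 < ρ := by positivity
  have hρ1 : ρ < 1 := by rw [hρdef]; linarith
  have hρ4 : 4 * t < ρ := by rw [hρdef]; linarith
  have hρ : t * (1 + ρ) ^ 2 < ρ := by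
    have : t * (1 + ρ) ^ 2 ≤ t * 2 ^ 2 := by gcongr; linarith
    linarith
  set b₂ : ℂ → ℂ := fun z => ∑' n, (d.b (n + 2) : ℂ) * z ^ n with hb₂
  set A : ℂ → ℂ := fun z => ∑' n, (d.a n : ℂ) * z ^ n with hA
  set DB : ℂ → ℂ := fun z => ∑' n, (d.dB n : ℂ) * z ^ n with hDB
  set DA : ℂ → ℂ := fun z => ∑' n, (d.dA n : ℂ) * z ^ n with hDA
  have sb₂ : Summable fun n => d.b (n + 2) := (summable_nat_add_iff 2).mpr d.b_summable
  have b₂c : ContinuousOn b₂ (closedBall 0 1) := continuousOn_cseries sb₂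
  have b₂d : DifferentiableOn ℂ b₂ (ball 0 1) := differentiableOn_cseries sb₂
  have Ac : ContinuousOn A (closedBall 0 1) := continuousOn_cseries d.a_summable
  have Ad : DifferentiableOn ℂ A (ball 0 1) := differentiableOn_cseries d.a_summable
  have DBd : DifferentiableOn ℂ DB (ball 0 1) := differentiableOn_cseries d.dB_summable
  have DAd : DifferentiableOn ℂ DA (ball 0 1) := differentiableOn_cseries d.dA_summable
  set G : ℂ → ℂ := fun z => m / 2 + z * b₂ z with hG
  have Gc : ContinuousOn G (closedBall 0 1) := by fun_prop
  have Gd : DifferentiableOn ℂ G (ball 0 1) := by fun_prop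
  set R : ℂ → ℂ := fun z => 1 / t - c + z * (G z - 2) with hR
  have Rc : ContinuousOn R (closedBall 0 1) := by fun_prop
  have Rd : DifferentiableOn ℂ R (ball 0 1) := by fun_prop
  set H₁ : ℂ → ℂ := fun z => (-2 + z * R z) *
    (4 * c * b₂ z - 2 * G z ^ 2 + R z * (-2 * c + z * G z) * G z + 2 * m * G z) with hH₁
  set W : ℂ → ℂ := fun z => -2 * G z + R z * (-c + z * G z) with hW
  have Wc : ContinuousOn W (closedBall 0 1) := by fun_prop
  have Wd : DifferentiableOn ℂ W (ball 0 1) := by fun_prop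
  set H₂ : ℂ → ℂ := fun z => -4 * c / t * G z + 2 * c * (2 + A z) * (-c + z * G z) + W z ^ 2
    - (2 * c ^ 2 - m) * W z + 4 * c * b₂ z
    + 4 * c * (-2 * b₂ z - c * (G z - 2) + R z * G z) with hH₂
  set D' : ℂ → ℂ := fun z => DB z + 2 / (t * (1 + z)) with hD'
  set E' : ℂ → ℂ := fun z => DA z + 2 / (t ^ 2 * (1 + z) ^ 2) with hE'
  set M : ℂ → ℂ := fun z => (1 - z) / (2 * t * (1 + z)) with hM
  set θ : ℂ → ℂ := fun z => z - 4 * t ^ 2 * (1 + z) ^ 2 with hθ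
  have hne : ∀ z ∈ ball (0 : ℂ) 1, 1 + z ≠ 0 := fun z hz h => by
    rw [mem_ball_zero_iff, show z = -1 by linear_combination h, norm_neg, norm_one] at hz
    exact lt_irrefl _ hz
  have D'd : DifferentiableOn ℂ D' (ball 0 1) :=
    DBd.add (by
      refine DifferentiableOn.div (by fun_prop) (by fun_prop) fun z hz => ?_
      exact mul_ne_zero htC (hne z hz))
  have E'd : DifferentiableOn ℂ E' (ball 0 1) :=
    DAd.add (by
      refine DifferentiableOn.div (by fun_prop) (by fun_prop) fun z hz => ?_
      exact mul_ne_zero (pow_ne_zero _ htC) (pow_ne_zero _ (hne z hz)))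
  have Md : DifferentiableOn ℂ M (ball 0 1) := by
    refine DifferentiableOn.div (by fun_prop) (by fun_prop) fun z hz => ?_
    exact mul_ne_zero (mul_ne_zero two_ne_zero htC) (hne z hz)
  set V : ℂ → ℂ := fun z => D' z * (z * D' z + 2 * M z) with hV
  have Vd : DifferentiableOn ℂ V (ball 0 1) := by fun_prop
  set L₁ : ℂ → ℂ := fun z => θ z * (θ z * V z ^ 2 - c ^ 2 * (z * D' z ^ 2) + 2 * m * V z) with hL₁
  set L₂ : ℂ → ℂ := fun z => θ z *
    (2 * c * (E' z * (z * D' z + 2 * M z)) + θ z * V z ^ 2 - (2 * c ^ 2 - m) * V z) with hL₂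
  have θd : DifferentiableOn ℂ θ (ball 0 1) := by fun_prop
  obtain ⟨Z, ⟨hZ0, hZρ⟩, hZ⟩ : ∃ Z ∈ Ioo 0 ρ, Z - 4 * t ^ 2 * (1 + Z) ^ 2 = 0 := by
    refine intermediate_value_Ioo hρ0.le (f := fun Z => Z - 4 * t ^ 2 * (1 + Z) ^ 2)
      (by fun_prop) ⟨by simpa using pow_pos ht0 2, ?_⟩
    change 0 < ρ - 4 * t ^ 2 * (1 + ρ) ^ 2
    nlinarith
  have θZ : θ Z = 0 := by simp only [hθ]; exact_mod_cast hZ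
  have hZn : ‖(Z : ℂ)‖ ≤ ρ := by
    rw [Complex.norm_real, Real.norm_eq_abs, abs_of_pos hZ0]; exact hZρ.le
  have key : ∀ X : ℂ, X ≠ 0 → ‖X‖ ≤ 1 → ∀ a b σ y v S : ℂ, a = A X →
      b = ∑' n, (d.b n : ℂ) * X ^ n → σ = b - 2 / X → y = b - 1 / t + 2 * X → v = σ * y →
      S = 2 / X ^ 2 - 2 / (t * X) + 2 + a →
      H₁ X = v ^ 2 - c ^ 2 * σ ^ 2 + 2 * m * v ∧
      H₂ X = 2 * c * (S * y) + v ^ 2 - (2 * c ^ 2 - m) * v := by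
    intro X hX hX1 a b σ y v S ea eb hσ hy hv hS
    have eb' : b = d.b 0 + d.b 1 * X + X ^ 2 * b₂ X := by
      rw [eb, cseries_split d.b_summable hX1]
    have e0 : (d.b 0 : ℂ) = 1 / t - c := by rw [hcdef]; ring
    have e1 : (d.b 1 : ℂ) = (m - 4) / 2 := by rw [hm]; ring
    rw [e0, e1] at eb'
    rw [hS, hv, hσ, hy, eb', ea]
    simp only [hH₁, hH₂, hW, hR, hG]
    generalize b₂ X = B
    generalize A X = A
    constructor <;> field_simp <;> ring
  have inv : ∀ X Y : ℂ, X ≠ 0 → Y ≠ 0 → ‖X‖ ≤ 1 → ‖Y‖ ≤ ρ →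
      t * (1 + Y) * (1 + X ^ 2 * Y) = X * Y → H₁ X = L₁ Y ∧ H₂ X = L₂ Y := by
    intro X Y hX hY hX1 hYρ hc
    obtain ⟨k1, k2⟩ := key X hX hX1 _ _ _ _ _ _ rfl rfl rfl rfl rfl rfl
    obtain ⟨i1, i2, i3⟩ := curve_invariants htC hX hY
      (hne Y (mem_ball_zero_iff.mpr (hYρ.trans_lt hρ1))) hc
      (d.kernelB X Y hX hY hX1 (hYρ.trans hρ1.le) hc)
      (d.kernelA X Y hX hY hX1 (hYρ.trans hρ1.le) hc)
    rw [k1, k2, i1, i2, i3]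
    simp only [hL₁, hL₂, hV]
    constructor <;> ring
  have H₁c : ContinuousOn H₁ (closedBall 0 1) := by fun_prop
  have H₁d : DifferentiableOn ℂ H₁ (ball 0 1) := by fun_prop
  have H₂c : ContinuousOn H₂ (closedBall 0 1) := by fun_prop
  have H₂d : DifferentiableOn ℂ H₂ (ball 0 1) := by fun_prop
  have L₁d : DifferentiableOn ℂ L₁ (ball 0 1) := by fun_prop
  have L₂d : DifferentiableOn ℂ L₂ (ball 0 1) := by fun_prop
  obtain ⟨k1, k2⟩ := key X hX hX1 a b σ y v S ea eb hσ hy hv hS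
  rw [← k1, ← k2, eq_const_of_invariant ht0 hρ0 hρ1 hρ H₁d H₁c L₁d
      (fun X Y h1 h2 h3 h4 h5 => (inv X Y h1 h2 h3 h4 h5).1) hX1 hZn,
    eq_const_of_invariant ht0 hρ0 hρ1 hρ H₂d H₂c L₂d
      (fun X Y h1 h2 h3 h4 h5 => (inv X Y h1 h2 h3 h4 h5).2) hX1 hZn]
  simp only [hL₁, hL₂, θZ, zero_mul, and_self]

end Invariants

section CriticalPoints

open Set Filter Topology Metric

theorem eq_zero_of_abs_le_mul {F G : ℝ → ℝ} {k : ℝ} (hk : 0 < k)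
    (hF : ContinuousOn F (Ioc 0 1)) (hG : ContinuousOn G (Ioc 0 1))
    (h : ∀ x ∈ Ioo 0 1, (1 - x) * k * |F x| ≤ (1 - x) ^ 2 * |G x|) : F 1 = 0 := by
  have h1 : (1 : ℝ) ∈ Ioc (0 : ℝ) 1 := by simp
  have hle : 𝓝[Ioo 0 1] (1 : ℝ) ≤ 𝓝[Ioc 0 1] 1 := nhdsWithin_mono _ Ioo_subset_Ioc_self
  have lF : Tendsto (fun x => k * |F x|) (𝓝[Ioo 0 1] 1) (𝓝 (k * |F 1|)) :=
    ((hF 1 h1).mono_left hle).abs.const_mul k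
  have lG : Tendsto (fun x => (1 - x) * |G x|) (𝓝[Ioo 0 1] 1) (𝓝 ((1 - 1) * |G 1|)) :=
    Tendsto.mul ((continuous_const.sub continuous_id).continuousWithinAt)
      ((hG 1 h1).mono_left hle).abs
  have : (𝓝[Ioo (0 : ℝ) 1] 1).NeBot := by
    rw [nhdsWithin_Ioo_eq_nhdsLT one_pos]; infer_instance
  have hlim := le_of_tendsto_of_tendsto lF lG (by
    filter_upwards [self_mem_nhdsWithin] with x hx
    have h0 : 0 < 1 - x := sub_pos.mpr hx.2
    refine le_of_mul_le_mul_left ?_ h0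
    linarith [h x hx])
  rw [sub_self, zero_mul] at hlim
  have h0 : |F 1| ≤ 0 := by nlinarith [abs_nonneg (F 1)]
  exact abs_nonpos_iff.mp h0

theorem continuousOn_series {a : ℕ → ℝ} (ha : Summable a) :
    ContinuousOn (fun x : ℝ => ∑' n, a n * x ^ n) (Icc (-1) 1) := by
  refine continuousOn_tsum (fun i => by fun_prop) ha.norm fun n x hx => ?_
  rw [norm_mul, norm_pow, Real.norm_eq_abs x]
  exact mul_le_of_le_one_right (norm_nonneg _) (pow_le_one₀ (abs_nonneg _) (abs_le.mpr hx))

theorem ofReal_series (a : ℕ → ℝ) (x : ℝ) :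
    ((∑' n, a n * x ^ n : ℝ) : ℂ) = ∑' n, (a n : ℂ) * (x : ℂ) ^ n := by
  rw [Complex.ofReal_tsum]
  exact tsum_congr fun n => by push_cast; rfl

namespace ConeData

variable {t : ℝ} (d : ConeData t)

/-- The boundary series of the first Green function. -/
noncomputable def bSer (x : ℝ) : ℝ := ∑' n, d.b n * x ^ n

/-- The uniformizing combination `b - 1/t + 2x`. -/
noncomputable def ySer (x : ℝ) : ℝ := d.bSer x - 1 / t + 2 * x

/-- The pole part `b - 2/x`. -/
noncomputable def sSer (x : ℝ) : ℝ := d.bSer x - 2 / x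

/-- The critical value constant. -/
noncomputable def cPar : ℝ := 1 / t - d.b 0

/-- The linear coefficient constant. -/
noncomputable def mPar : ℝ := 4 + 2 * d.b 1

theorem relations (ht0 : 0 < t) (ht : t < 1 / 4) {x : ℝ} (hx : x ≠ 0) (hx1 : |x| ≤ 1) :
    (d.sSer x * d.ySer x) ^ 2 - d.cPar ^ 2 * d.sSer x ^ 2 +
      2 * d.mPar * (d.sSer x * d.ySer x) = 0 ∧
    2 * d.cPar * ((2 / x ^ 2 - 2 / (t * x) + 2 + ∑' n, d.a n * x ^ n) * d.ySer x) +
      (d.sSer x * d.ySer x) ^ 2 -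
      (2 * d.cPar ^ 2 - d.mPar) * (d.sSer x * d.ySer x) = 0 := by
  have := d.complex_relations ht0 ht (X := x) (by exact_mod_cast hx)
    (by rwa [Complex.norm_real, Real.norm_eq_abs]) (ofReal_series d.a x) (ofReal_series d.b x)
    (c := (d.cPar : ℂ)) (m := (d.mPar : ℂ)) (by simp [cPar]) (by simp [mPar]) rfl rfl rfl rfl
  constructor
  · have h := this.1
    rw [← Complex.ofReal_inj]
    simp only [sSer, ySer, bSer]
    push_cast at h ⊢
    exact h
  · have h := this.2
    rw [← Complex.ofReal_inj]
    simp only [sSer, ySer, bSer]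
    push_cast at h ⊢
    exact h

theorem cubic (ht0 : 0 < t) (ht : t < 1 / 4) {x : ℝ} (hx : x ≠ 0) (hx1 : |x| ≤ 1)
    (hs : d.sSer x ≠ 0) {N : ℝ} (hN : N = x + 1 / x - 1 / (2 * t)) :
    d.ySer x ^ 3 - 2 * N * d.ySer x ^ 2 + (2 * d.mPar - d.cPar ^ 2) * d.ySer x +
      2 * N * d.cPar ^ 2 = 0 := by
  have h := (d.relations ht0 ht hx hx1).1
  have e : d.sSer x = d.ySer x - 2 * N := by
    rw [hN, sSer, ySer]; field_simp; ring
  refine (mul_eq_zero.mp (?_ : d.sSer x * _ = 0)).resolve_left hs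
  rw [← h, e]
  ring

theorem bSer_mono {x y : ℝ} (hx : 0 ≤ x) (hxy : x ≤ y) (hy : y ≤ 1) : d.bSer x ≤ d.bSer y := by
  refine (summable_series d.b_summable (abs_le.mpr ⟨by linarith, by linarith⟩)).tsum_le_tsum
    (fun n => ?_) (summable_series d.b_summable (abs_le.mpr ⟨by linarith, hy⟩))
  exact mul_le_mul_of_nonneg_left (pow_le_pow_left₀ hx hxy n) (d.b_nonneg n)

theorem sSer_one : d.sSer 1 = -((1 - 4 * t) * d.massB) := by
  have := d.balanceB
  simp only [sSer, bSer, one_pow, mul_one]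
  linarith

theorem sSer_neg (ht : t < 1 / 4) {x : ℝ} (hx : 0 < x) (hx1 : x ≤ 1) : d.sSer x < 0 := by
  have h1 : d.sSer 1 < 0 := by
    rw [sSer_one]; nlinarith [mul_pos (by linarith : 0 < 1 - 4 * t) d.massB_pos]
  have h2 := d.bSer_mono hx.le hx1 le_rfl
  have h3 : 2 / 1 ≤ 2 / x := div_le_div_of_nonneg_left (by norm_num) hx hx1
  simp only [sSer] at h1 ⊢
  linarith

theorem continuousOn_bSer : ContinuousOn d.bSer (Icc (-1) 1) := continuousOn_series d.b_summable

theorem critical_one (ht0 : 0 < t) (ht : t < 1 / 4) :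
    3 * d.ySer 1 ^ 2 - 4 * (2 - 1 / (2 * t)) * d.ySer 1 + 2 * d.mPar - d.cPar ^ 2 = 0 := by
  set N₁ := 2 - 1 / (2 * t) with hN₁
  set y₁ := d.ySer 1 with hy₁
  have hbc : ContinuousOn d.bSer (Ioc 0 1) :=
    d.continuousOn_bSer.mono fun x hx => ⟨by linarith [hx.1], hx.2⟩
  have hyc : ContinuousOn d.ySer (Ioc 0 1) := by
    change ContinuousOn (fun x => d.bSer x - 1 / t + 2 * x) _
    fun_prop
  have h := eq_zero_of_abs_le_mul (k := 2) two_pos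
    (F := fun x => d.ySer x ^ 2 + d.ySer x * y₁ + y₁ ^ 2 - 2 * N₁ * (d.ySer x + y₁) +
      2 * d.mPar - d.cPar ^ 2)
    (G := fun x => (2 * d.cPar ^ 2 - 2 * d.ySer x ^ 2) / x) (by fun_prop)
    (by
      refine ContinuousOn.div (by fun_prop) (by fun_prop) fun x hx => hx.1.ne') ?_
  · simp only [← hy₁] at h
    linear_combination h
  · intro x hx
    have hx0 : x ≠ 0 := hx.1.ne'
    have c1 := d.cubic ht0 ht hx0 (abs_le.mpr ⟨by linarith [hx.1], hx.2.le⟩)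
      (d.sSer_neg ht hx.1 hx.2.le).ne rfl
    have c2 := d.cubic ht0 ht one_ne_zero (by simp) (d.sSer_neg ht one_pos le_rfl).ne
      (N := N₁) (by rw [hN₁]; norm_num)
    rw [← hy₁] at c2
    have hy : 2 * (1 - x) ≤ y₁ - d.ySer x := by
      have := d.bSer_mono hx.1.le hx.2.le le_rfl
      simp only [hy₁, ySer]
      linarith
    set F := d.ySer x ^ 2 + d.ySer x * y₁ + y₁ ^ 2 - 2 * N₁ * (d.ySer x + y₁) +
      2 * d.mPar - d.cPar ^ 2 with hF
    have hid : (y₁ - d.ySer x) * F = (1 - x) ^ 2 * ((2 * d.cPar ^ 2 - 2 * d.ySer x ^ 2) / x) := by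
      have e : x + 1 / x - 1 / (2 * t) = N₁ + (1 - x) ^ 2 / x := by
        rw [hN₁]; field_simp; ring
      rw [e] at c1
      rw [mul_div_assoc', mul_comm ((1 - x) ^ 2), mul_div_assoc, hF]
      linear_combination c2 - c1
    have h0 : 0 < 1 - x := sub_pos.mpr hx.2
    calc (1 - x) * 2 * |F| ≤ |y₁ - d.ySer x| * |F| := by
          gcongr
          exact (by linarith : (1 - x) * 2 ≤ y₁ - d.ySer x).trans (le_abs_self _)
      _ = |(1 - x) ^ 2 * ((2 * d.cPar ^ 2 - 2 * d.ySer x ^ 2) / x)| := by rw [← abs_mul, hid]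
      _ = _ := by rw [abs_mul, abs_of_nonneg (sq_nonneg (1 - x))]

/-- The regularised diagonal series at negative arguments. -/
noncomputable def gSer (z : ℝ) : ℝ := ∑' n, (2 / t + (-1) ^ n * d.dB n) * z ^ n

theorem gSer_coeff_nonneg (ht0 : 0 < t) (ht : t < 1 / 4) (n : ℕ) :
    0 ≤ 2 / t + (-1) ^ n * d.dB n := by
  have h1 : 8 ≤ 2 / t := by rw [le_div_iff₀ ht0]; linarith
  have h2 := d.dB_le n
  have h3 := d.dB_nonneg n
  rcases neg_one_pow_eq_or ℝ n with h | h <;> rw [h] <;> linarith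

theorem hasSum_gSer {z : ℝ} (hz0 : 0 ≤ z) (hz1 : z < 1) :
    HasSum (fun n => (2 / t + (-1) ^ n * d.dB n) * z ^ n)
      (∑' n, d.dB n * (-z) ^ n + 2 / (t * (1 - z))) := by
  have h1 := (hasSum_geometric_of_lt_one hz0 hz1).mul_left (2 / t)
  have h2 := (summable_series d.dB_summable (x := -z)
    (by rw [abs_neg, abs_of_nonneg hz0]; exact hz1.le)).hasSum
  convert h2.add h1 using 1
  · ext n
    rw [neg_pow z]
    ring
  · rw [← div_eq_mul_inv, div_div]

theorem gSer_mono (ht0 : 0 < t) (ht : t < 1 / 4) {z w : ℝ} (hz : 0 ≤ z) (hzw : z ≤ w)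
    (hw : w < 1) : d.gSer z ≤ d.gSer w :=
  (d.hasSum_gSer hz (hzw.trans_lt hw)).summable.tsum_le_tsum
    (fun n => mul_le_mul_of_nonneg_left (pow_le_pow_left₀ hz hzw n)
      (d.gSer_coeff_nonneg ht0 ht n)) (d.hasSum_gSer (hz.trans hzw) hw).summable

theorem le_gSer (ht0 : 0 < t) (ht : t < 1 / 4) {z : ℝ} (hz : 0 ≤ z) (hz1 : z < 1) :
    2 / t ≤ d.gSer z := by
  have := (d.hasSum_gSer hz hz1).summable.le_tsum 0 fun n _ =>
    mul_nonneg (d.gSer_coeff_nonneg ht0 ht n) (pow_nonneg hz n)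
  simp only [pow_zero, one_mul, mul_one] at this
  exact (by linarith [d.dB_nonneg 0] : 2 / t ≤ 2 / t + d.dB 0).trans this

theorem sSer_sq {x z : ℝ} (ht0 : 0 < t) (hx : 0 < x) (hx1 : x ≤ 1) (hz : 0 < z) (hz1 : z < 1)
    (hc : t * (1 - z) * (1 - x ^ 2 * z) = x * z) :
    d.sSer (-x) ^ 2 = (z ^ 2 + 4 * t ^ 2 * z * (1 - z) ^ 2) * d.gSer z ^ 2 := by
  have hxn : ‖((-x : ℝ) : ℂ)‖ ≤ 1 := by
    rw [Complex.norm_real, Real.norm_eq_abs, abs_neg, abs_of_pos hx]; exact hx1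
  have hzn : ‖((-z : ℝ) : ℂ)‖ ≤ 1 := by
    rw [Complex.norm_real, Real.norm_eq_abs, abs_neg, abs_of_pos hz]; exact hz1.le
  have hX : ((-x : ℝ) : ℂ) ≠ 0 := by exact_mod_cast (neg_ne_zero.mpr hx.ne')
  have hY : ((-z : ℝ) : ℂ) ≠ 0 := by exact_mod_cast (neg_ne_zero.mpr hz.ne')
  have hc' : (t : ℂ) * (1 + ((-z : ℝ) : ℂ)) * (1 + ((-x : ℝ) : ℂ) ^ 2 * ((-z : ℝ) : ℂ)) =
      ((-x : ℝ) : ℂ) * ((-z : ℝ) : ℂ) := by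
    have : t * (1 + -z) * (1 + (-x) ^ 2 * (-z)) = -x * -z := by linear_combination hc
    exact_mod_cast this
  have h := (curve_invariants (by exact_mod_cast ht0.ne') hX hY
    (by exact_mod_cast (by linarith : 1 + -z ≠ 0)) hc'
    (d.kernelB _ _ hX hY hxn hzn hc') (d.kernelA _ _ hX hY hxn hzn hc')).1
  rw [← ofReal_series, ← ofReal_series] at h
  rw [gSer, (d.hasSum_gSer hz.le hz1).tsum_eq, sSer, bSer]
  have h' : ((∑' n, d.b n * (-x) ^ n) - 2 / (-x)) ^ 2 = (-z - 4 * t ^ 2 * (1 + -z) ^ 2) *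
      (-z * (∑' n, d.dB n * (-z) ^ n + 2 / (t * (1 + -z))) ^ 2) := by exact_mod_cast h
  rw [h']
  ring

theorem exists_curve_neg (ht0 : 0 < t) {x : ℝ} (hx : 0 < x) :
    ∃ z ∈ Ioo (0 : ℝ) 1, t * (1 - z) * (1 - x ^ 2 * z) = x * z := by
  obtain ⟨z, hz, h⟩ := intermediate_value_Ioo' zero_le_one
    (f := fun z => t * (1 - z) * (1 - x ^ 2 * z) - x * z) (by fun_prop)
    (show (0 : ℝ) ∈ Ioo _ _ by
      refine ⟨?_, ?_⟩
      · simpa using hx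
      · simpa using ht0)
  exact ⟨z, hz, by linarith⟩

theorem sSer_neg_ne_zero (ht0 : 0 < t) (ht : t < 1 / 4) {x : ℝ} (hx : 0 < x) (hx1 : x ≤ 1) :
    d.sSer (-x) ≠ 0 := by
  obtain ⟨z, ⟨hz, hz1⟩, hc⟩ := exists_curve_neg ht0 hx
  have h := d.sSer_sq ht0 hx hx1 hz hz1 hc
  have hg : 0 < d.gSer z := (by positivity : 0 < 2 / t).trans_le (d.le_gSer ht0 ht hz.le hz1)
  intro h0
  rw [h0] at h
  have : 0 < (z ^ 2 + 4 * t ^ 2 * z * (1 - z) ^ 2) * d.gSer z ^ 2 := by positivity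
  linarith

theorem exists_sSer_sq_gap (ht0 : 0 < t) (ht : t < 1 / 4) :
    ∃ k > 0, ∀ x ∈ Ioo (0 : ℝ) 1, (1 - x) * k ≤ d.sSer (-x) ^ 2 - d.sSer (-1) ^ 2 := by
  obtain ⟨w, ⟨hw, hw1⟩, hcw⟩ := exists_curve_neg ht0 one_pos
  refine ⟨1 / 2 * w ^ 2 * (2 / t) ^ 2, by positivity, fun x hx => ?_⟩
  obtain ⟨z, ⟨hz, hz1⟩, hcz⟩ := exists_curve_neg ht0 hx.1
  rw [d.sSer_sq ht0 hx.1 hx.2.le hz hz1 hcz, d.sSer_sq ht0 one_pos le_rfl hw hw1 hcw]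
  have h0 : 0 < 1 - x := sub_pos.mpr hx.2
  have hdiff : (z - w) * (1 + t * (2 - z - w)) = (1 - x) * z * (1 + t * (1 - z) * (1 + x)) := by
    linear_combination hcw - hcz
  have hpos : 0 < 1 + t * (2 - z - w) := by nlinarith
  have hzw : 0 ≤ z - w := by
    refine le_of_mul_le_mul_right ?_ hpos
    rw [zero_mul, hdiff]
    have := hx.1
    have : 0 < 1 - z := by linarith
    positivity
  have hle : (1 - x) * w * (2 / 3) ≤ z - w := by
    have h1 : (1 - x) * z * 1 ≤ (1 - x) * z * (1 + t * (1 - z) * (1 + x)) := by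
      have := hx.1
      have : 0 < 1 - z := by linarith
      gcongr
      have : 0 < t * (1 - z) * (1 + x) := by positivity
      linarith
    have h2 : (z - w) * (1 + t * (2 - z - w)) ≤ (z - w) * (3 / 2) := by
      gcongr; nlinarith
    have h3 : (1 - x) * w ≤ (1 - x) * z := by gcongr; linarith
    linarith
  have hg := d.gSer_mono ht0 ht hw.le (by linarith : w ≤ z) hz1
  have hg0 := d.le_gSer ht0 ht hw.le hw1
  have ht2 : 0 < 2 / t := by positivity
  have hpoly : 3 / 4 * w * (z - w) ≤
      z ^ 2 + 4 * t ^ 2 * z * (1 - z) ^ 2 - (w ^ 2 + 4 * t ^ 2 * w * (1 - w) ^ 2) := by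
    have e : z ^ 2 + 4 * t ^ 2 * z * (1 - z) ^ 2 - (w ^ 2 + 4 * t ^ 2 * w * (1 - w) ^ 2) =
        (z + w + 4 * t ^ 2 * ((1 - (z + w)) ^ 2 - z * w)) * (z - w) := by ring
    rw [e]
    gcongr
    have t2 : 4 * t ^ 2 ≤ 1 / 4 := by nlinarith
    have p1 : 4 * t ^ 2 * (z * w) ≤ 1 / 4 * (1 * w) := by gcongr
    have p2 : 0 ≤ 4 * t ^ 2 * (1 - (z + w)) ^ 2 := by positivity
    nlinarith
  have hp0 : 0 ≤ z ^ 2 + 4 * t ^ 2 * z * (1 - z) ^ 2 := by positivity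
  calc (1 - x) * (1 / 2 * w ^ 2 * (2 / t) ^ 2)
      = 3 / 4 * w * ((1 - x) * w * (2 / 3)) * (2 / t) ^ 2 := by ring
    _ ≤ 3 / 4 * w * (z - w) * (2 / t) ^ 2 := by gcongr
    _ ≤ 3 / 4 * w * (z - w) * d.gSer w ^ 2 := by gcongr
    _ ≤ (z ^ 2 + 4 * t ^ 2 * z * (1 - z) ^ 2 - (w ^ 2 + 4 * t ^ 2 * w * (1 - w) ^ 2)) *
        d.gSer w ^ 2 := by gcongr
    _ = (z ^ 2 + 4 * t ^ 2 * z * (1 - z) ^ 2) * d.gSer w ^ 2 -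
        (w ^ 2 + 4 * t ^ 2 * w * (1 - w) ^ 2) * d.gSer w ^ 2 := by ring
    _ ≤ _ := by
      have : 0 ≤ d.gSer w := ht2.le.trans hg0
      gcongr

theorem critical_neg_one (ht0 : 0 < t) (ht : t < 1 / 4) :
    3 * d.ySer (-1) ^ 2 - 4 * (-2 - 1 / (2 * t)) * d.ySer (-1) + 2 * d.mPar - d.cPar ^ 2 = 0 := by
  set N₂ := -2 - 1 / (2 * t) with hN₂
  set y₂ := d.ySer (-1) with hy₂
  set s₂ := d.sSer (-1) with hs₂
  obtain ⟨k, hk, hgap⟩ := d.exists_sSer_sq_gap ht0 ht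
  have hbc : ContinuousOn (fun x => d.bSer (-x)) (Ioc 0 1) :=
    d.continuousOn_bSer.comp (by fun_prop) fun x hx =>
      ⟨by linarith [hx.2], by linarith [hx.1]⟩
  have hyc : ContinuousOn (fun x => d.ySer (-x)) (Ioc 0 1) := by
    change ContinuousOn (fun x => d.bSer (-x) - 1 / t + 2 * (-x)) _
    fun_prop
  have hsc : ContinuousOn (fun x => d.sSer (-x)) (Ioc 0 1) := by
    change ContinuousOn (fun x => d.bSer (-x) - 2 / (-x)) _
    exact hbc.sub (ContinuousOn.div (by fun_prop) (by fun_prop) fun x hx =>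
      neg_ne_zero.mpr hx.1.ne')
  have hFc : ContinuousOn (fun x => d.ySer (-x) ^ 2 + d.ySer (-x) * y₂ + y₂ ^ 2 -
      2 * N₂ * (d.ySer (-x) + y₂) + 2 * d.mPar - d.cPar ^ 2) (Ioc 0 1) := by fun_prop
  have h := eq_zero_of_abs_le_mul hk hFc
    (G := fun x => (d.sSer (-x) + s₂) * (2 * d.cPar ^ 2 - 2 * d.ySer (-x) ^ 2 +
      2 * (d.ySer (-x) ^ 2 + d.ySer (-x) * y₂ + y₂ ^ 2 - 2 * N₂ * (d.ySer (-x) + y₂) +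
      2 * d.mPar - d.cPar ^ 2)) / x)
    (by
      refine ContinuousOn.div (by fun_prop) (by fun_prop) fun x hx => hx.1.ne') ?_
  · simp only [← hy₂] at h
    linear_combination h
  · intro x hx
    have hx0 : x ≠ 0 := hx.1.ne'
    have c1 := d.cubic ht0 ht (neg_ne_zero.mpr hx0)
      (by rw [abs_neg, abs_of_pos hx.1]; exact hx.2.le)
      (d.sSer_neg_ne_zero ht0 ht hx.1 hx.2.le) rfl
    have c2 := d.cubic ht0 ht (x := -1) (by norm_num) (by simp)
      (d.sSer_neg_ne_zero ht0 ht one_pos le_rfl)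
      (N := N₂) (by rw [hN₂]; norm_num)
    rw [← hy₂] at c2
    set y := d.ySer (-x) with hy
    set s := d.sSer (-x) with hs
    set F := y ^ 2 + y * y₂ + y₂ ^ 2 - 2 * N₂ * (y + y₂) + 2 * d.mPar - d.cPar ^ 2 with hF
    have e : -x + 1 / -x - 1 / (2 * t) = N₂ - (1 - x) ^ 2 / x := by
      rw [hN₂]; field_simp; ring
    rw [e] at c1
    have es : s - s₂ = y - y₂ + 2 * ((1 - x) ^ 2 / x) := by
      rw [hs, hs₂, hy, hy₂]
      simp only [sSer, ySer]
      field_simp; ring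
    have hid : (s ^ 2 - s₂ ^ 2) * F =
        (1 - x) ^ 2 * ((s + s₂) * (2 * d.cPar ^ 2 - 2 * y ^ 2 + 2 * F) / x) := by
      have hyF : (y - y₂) * F = (1 - x) ^ 2 / x * (2 * d.cPar ^ 2 - 2 * y ^ 2) := by
        rw [hF]; linear_combination c1 - c2
      have : (1 - x) ^ 2 * ((s + s₂) * (2 * d.cPar ^ 2 - 2 * y ^ 2 + 2 * F) / x) =
        (1 - x) ^ 2 / x * ((s + s₂) * (2 * d.cPar ^ 2 - 2 * y ^ 2 + 2 * F)) := by ring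
      rw [this]
      linear_combination (s + s₂) * F * es + (s + s₂) * hyF
    calc (1 - x) * k * |F| ≤ |s ^ 2 - s₂ ^ 2| * |F| := by
          gcongr
          exact (hgap x hx).trans (le_abs_self _)
      _ = _ := by rw [← abs_mul, hid, abs_mul, abs_of_nonneg (sq_nonneg (1 - x))]

end ConeData

end CriticalPoints

section Asymptotics

open Set Filter Topology

/-- The algebraic relations between the critical values at a fixed value of `t`. -/
theorem ConeData.algebraic_relations {t : ℝ} (d : ConeData t) (ht0 : 0 < t) (ht : t < 1 / 4) :
    ∃ p q C : ℝ, 0 < p ∧ p < q ∧ 0 < C ∧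
      p ^ 3 = (1 / (2 * t) - 2) * (p ^ 2 + C) ∧ q ^ 3 = (1 / (2 * t) + 2) * (q ^ 2 + C) ∧
      3 * C ^ 2 = (p ^ 2 + q ^ 2) * C + p ^ 2 * q ^ 2 ∧
      4 * C * ((1 - 4 * t) * (d.massA + 2 / t)) ^ 2 = (-p + 2 * (1 / (2 * t) - 2)) ^ 2 *
        (3 * C - (p ^ 2 + q ^ 2) / 2 + (-p + 2 * (1 / (2 * t) - 2)) * p) ^ 2 := by
  set c := d.cPar
  set m := d.mPar
  have c1 := d.cubic ht0 ht one_ne_zero (by simp) (d.sSer_neg ht one_pos le_rfl).ne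
    (N := 2 - 1 / (2 * t)) (by norm_num)
  have c2 := d.cubic ht0 ht (x := -1) (by norm_num) (by simp)
    (d.sSer_neg_ne_zero ht0 ht one_pos le_rfl) (N := -2 - 1 / (2 * t)) (by norm_num)
  have r1 := d.critical_one ht0 ht
  have r2 := d.critical_neg_one ht0 ht
  have hS := (d.relations ht0 ht one_ne_zero (by simp)).2
  have hσ := d.sSer_neg ht one_pos le_rfl
  have eσ : d.sSer 1 = d.ySer 1 + 2 * (1 / (2 * t) - 2) := by
    simp only [sSer, ySer]; field_simp; ring
  have hbal := d.balanceA
  simp only [one_pow, mul_one, div_one] at hS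
  set p := -d.ySer 1 with hp
  set q := -d.ySer (-1) with hq
  have ep : d.ySer 1 = -p := by rw [hp, neg_neg]
  have eq' : d.ySer (-1) = -q := by rw [hq, neg_neg]
  rw [ep] at c1 r1 eσ hS
  rw [eq'] at c2 r2
  rw [eσ] at hσ hS
  set P := 1 / (2 * t) - 2 with hP
  have hP0 : 0 < P := by
    rw [hP, sub_pos, lt_div_iff₀ (by positivity)]; linarith
  have eN1 : 2 - 1 / (2 * t) = -P := by rw [hP]; ring
  have eN2 : -2 - 1 / (2 * t) = -(P + 4) := by rw [hP]; ring
  have eN3 : 1 / (2 * t) + 2 = P + 4 := by rw [hP]; ring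
  rw [eN1] at c1 r1
  rw [eN2] at c2 r2
  rw [eN3]
  have hp0 : 0 < p := by linarith
  have cub1 : p ^ 3 = P * (p ^ 2 + c ^ 2) := by linear_combination (c1 + p * r1) / 2
  have cub2 : q ^ 3 = (P + 4) * (q ^ 2 + c ^ 2) := by linear_combination (c2 + q * r2) / 2
  have hC : 0 < c ^ 2 := by
    have h1 : P * c ^ 2 = p ^ 2 * (p - P) := by linear_combination -cub1
    have h2 : 0 < P * c ^ 2 := by
      rw [h1]; exact mul_pos (pow_pos hp0 2) (by linarith)
    exact pos_of_mul_pos_right h2 hP0.le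
  have hq0 : 0 < q := by
    by_contra! h
    have : q ^ 3 ≤ 0 := Odd.pow_nonpos (by decide) h
    have h2 : 0 < (P + 4) * (q ^ 2 + c ^ 2) := by positivity
    linarith
  have hpq : p < q := by
    by_contra! h
    have h1 : P * ((p ^ 2 + c ^ 2) * (q ^ 2 + c ^ 2)) <
        (P + 4) * ((p ^ 2 + c ^ 2) * (q ^ 2 + c ^ 2)) := by gcongr; linarith
    have h2 : 0 ≤ p ^ 2 * q ^ 2 * (p - q) + c ^ 2 * (p ^ 3 - q ^ 3) := by
      have : 0 ≤ p ^ 3 - q ^ 3 := sub_nonneg.mpr (by gcongr)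
      have : 0 ≤ p - q := sub_nonneg.mpr h
      positivity
    have h3 : p ^ 2 * q ^ 2 * (p - q) + c ^ 2 * (p ^ 3 - q ^ 3) =
        P * ((p ^ 2 + c ^ 2) * (q ^ 2 + c ^ 2)) -
        (P + 4) * ((p ^ 2 + c ^ 2) * (q ^ 2 + c ^ 2)) := by
      linear_combination (q ^ 2 + c ^ 2) * cub1 - (p ^ 2 + c ^ 2) * cub2
    linarith
  have quad1 : 2 * m * (p ^ 2 + c ^ 2) = (p ^ 2 - c ^ 2) ^ 2 := by
    linear_combination (p ^ 2 + c ^ 2) * r1 - 4 * p * cub1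
  have quad2 : 2 * m * (q ^ 2 + c ^ 2) = (q ^ 2 - c ^ 2) ^ 2 := by
    linear_combination (q ^ 2 + c ^ 2) * r2 - 4 * q * cub2
  have hm : 2 * m = p ^ 2 + q ^ 2 - 2 * c ^ 2 := by
    have hne : q ^ 2 - p ^ 2 ≠ 0 := by
      have : p ^ 2 < q ^ 2 := by gcongr
      linarith
    refine mul_left_cancel₀ hne ?_
    linear_combination quad2 - quad1
  refine ⟨p, q, c ^ 2, hp0, hpq, hC, cub1, cub2, ?_, ?_⟩
  · rw [hm] at quad1
    linear_combination -quad1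
  · have hA : 2 - 2 / t + 2 + ∑' n, d.a n = -((1 - 4 * t) * (d.massA + 2 / t)) := by
      have : 2 / t * t = 2 := by field_simp
      linear_combination hbal - 4 * this
    rw [hA] at hS
    set E := (1 - 4 * t) * (d.massA + 2 / t)
    have h2 : 2 * c * E = -(-p + 2 * P) * (3 * c ^ 2 - (p ^ 2 + q ^ 2) / 2 + (-p + 2 * P) * p) := by
      refine mul_left_cancel₀ hp0.ne' ?_
      linear_combination hS + (-p + 2 * P) * p / 2 * hm
    calc 4 * c ^ 2 * E ^ 2 = (2 * c * E) ^ 2 := by ring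
      _ = _ := by rw [h2]; ring

/-- Asymptotics of the solutions of the algebraic system when its parameter tends to `0`. -/
theorem tendsto_of_algebraic_relations {ι : Type*} {l : Filter ι} {P p q C E : ι → ℝ}
    (hP : Tendsto P l (𝓝 0)) (hP0 : ∀ᶠ i in l, 0 < P i) (hp0 : ∀ᶠ i in l, 0 < p i)
    (hpq : ∀ᶠ i in l, p i < q i) (hC0 : ∀ᶠ i in l, 0 < C i)
    (hp : ∀ᶠ i in l, p i ^ 3 = P i * (p i ^ 2 + C i))
    (hq : ∀ᶠ i in l, q i ^ 3 = (P i + 4) * (q i ^ 2 + C i))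
    (hC : ∀ᶠ i in l, 3 * C i ^ 2 = (p i ^ 2 + q i ^ 2) * C i + p i ^ 2 * q i ^ 2)
    (hE : ∀ᶠ i in l, 4 * C i * E i ^ 2 = (-p i + 2 * P i) ^ 2 *
      (3 * C i - (p i ^ 2 + q i ^ 2) / 2 + (-p i + 2 * P i) * p i) ^ 2) :
    Tendsto (fun i => E i ^ 6 / P i ^ 2) l (𝓝 (2 ^ 28 / 3 ^ 9)) := by
  have hP1 : ∀ᶠ i in l, P i < 1 := hP.eventually_lt_const one_pos
  have bounds : ∀ᶠ i in l, 4 ≤ q i ∧ q i ≤ 10 ∧ C i ≤ 100 ∧ 0 ≤ 3 * C i - q i ^ 2 ∧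
      3 * C i - q i ^ 2 ≤ 4 * p i ^ 2 := by
    filter_upwards [hP0, hP1, hp0, hpq, hC0, hq, hC] with i hP0 hP1 hp0 hpq hC0 hq hC
    have hq0 : 0 < q i := hp0.trans hpq
    have hq2 : 0 < q i ^ 2 := pow_pos hq0 2
    have hpq2 : p i ^ 2 ≤ q i ^ 2 := by gcongr
    have h1 : C i ≤ q i ^ 2 := by
      by_contra! h
      nlinarith
    have h2 : q i ≤ 2 * (P i + 4) := by
      refine le_of_mul_le_mul_right ?_ hq2
      calc q i * q i ^ 2 = (P i + 4) * (q i ^ 2 + C i) := by rw [← hq]; ring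
        _ ≤ (P i + 4) * (q i ^ 2 + q i ^ 2) := by gcongr
        _ = _ := by ring
    have h3 : 4 ≤ q i := by
      refine le_of_mul_le_mul_right ?_ hq2
      calc 4 * q i ^ 2 ≤ (P i + 4) * (q i ^ 2 + C i) := by gcongr <;> linarith
        _ = q i * q i ^ 2 := by rw [← hq]; ring
    have hid : (3 * C i - q i ^ 2) * C i = p i ^ 2 * (C i + q i ^ 2) := by linear_combination hC
    have h4 : 0 ≤ 3 * C i - q i ^ 2 := by
      refine le_of_mul_le_mul_right ?_ hC0
      rw [zero_mul, hid]; positivity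
    refine ⟨h3, by linarith, by nlinarith, h4, ?_⟩
    refine le_of_mul_le_mul_right ?_ hC0
    calc (3 * C i - q i ^ 2) * C i = p i ^ 2 * (C i + q i ^ 2) := hid
      _ ≤ p i ^ 2 * (C i + 3 * C i) := by gcongr; linarith
      _ = _ := by ring
  have lp3 : Tendsto (fun i => p i ^ 3) l (𝓝 0) := by
    have h0 : Tendsto (fun i => P i * 200) l (𝓝 0) := by simpa using hP.mul_const 200
    refine squeeze_zero' (hp0.mono fun i h => (pow_pos h 3).le) ?_ h0
    filter_upwards [hP0, hp0, hpq, hp, bounds] with i hP0 hp0 hpq hp ⟨_, h2, h3, _, _⟩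
    rw [hp]
    gcongr
    nlinarith
  have lp : Tendsto p l (𝓝 0) := by
    have h := lp3.rpow_const (p := (3 : ℝ)⁻¹) (Or.inr (by norm_num))
    rw [Real.zero_rpow (by norm_num)] at h
    refine h.congr' (hp0.mono fun i hi => ?_)
    exact Real.pow_rpow_inv_natCast hi.le (n := 3) (by norm_num)
  have lδ : Tendsto (fun i => 3 * C i - q i ^ 2) l (𝓝 0) := by
    have h0 : Tendsto (fun i => 4 * p i ^ 2) l (𝓝 0) := by simpa using (lp.pow 2).const_mul 4
    exact squeeze_zero' (bounds.mono fun i h => h.2.2.2.1) (bounds.mono fun i h => h.2.2.2.2) h0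
  have lδ' : Tendsto (fun i => (3 * C i - q i ^ 2) / (3 * q i ^ 2)) l (𝓝 0) := by
    refine squeeze_zero' (bounds.mono fun i h => ?_) (bounds.mono fun i h => ?_) lδ
    · exact div_nonneg h.2.2.2.1 (by positivity)
    · exact div_le_self h.2.2.2.1 (by nlinarith [h.1])
  have lq : Tendsto q l (𝓝 (16 / 3)) := by
    have h : Tendsto (fun i => (P i + 4) * (4 / 3 + (3 * C i - q i ^ 2) / (3 * q i ^ 2))) l
        (𝓝 ((0 + 4) * (4 / 3 + 0))) := (hP.add_const 4).mul (lδ'.const_add _)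
    rw [show (0 + 4) * (4 / 3 + 0) = (16 / 3 : ℝ) by norm_num] at h
    refine h.congr' ?_
    filter_upwards [hq, bounds] with i hq hb
    have hq0 : 0 < q i := by linarith [hb.1]
    field_simp
    linear_combination -3 * hq
  have lC : Tendsto C l (𝓝 (256 / 27)) := by
    have h := (lδ.add (lq.pow 2)).div_const 3
    norm_num at h
    exact h.congr fun i => by ring
  have lPp : Tendsto (fun i => P i / p i) l (𝓝 0) := by
    have h := (lp.pow 2).div ((lp.pow 2).add lC) (by norm_num)
    norm_num at h
    refine h.congr' ?_
    filter_upwards [hp0, hC0, hp] with i hp0 hC0 hp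
    have : 0 < p i ^ 2 + C i := by positivity
    change p i ^ 2 / (p i ^ 2 + C i) = P i / p i
    rw [div_eq_div_iff this.ne' hp0.ne']
    linear_combination hp
  have lmain : Tendsto (fun i => (-1 + 2 * (P i / p i)) ^ 6 * (p i ^ 2 + C i) ^ 2 *
      (3 * C i - (p i ^ 2 + q i ^ 2) / 2 + (-p i + 2 * P i) * p i) ^ 6 / (64 * C i ^ 3)) l
      (𝓝 ((-1 + 2 * 0) ^ 6 * (0 ^ 2 + 256 / 27) ^ 2 *
        (3 * (256 / 27) - (0 ^ 2 + (16 / 3) ^ 2) / 2 + (-0 + 2 * 0) * 0) ^ 6 /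
        (64 * (256 / 27) ^ 3))) := by
    refine Tendsto.div ?_ ((lC.pow 3).const_mul _) (by norm_num)
    refine ((((lPp.const_mul 2).const_add _).pow 6).mul (((lp.pow 2).add lC).pow 2)).mul ?_
    exact (((lC.const_mul 3).sub (((lp.pow 2).add (lq.pow 2)).div_const 2)).add
      ((lp.neg.add (hP.const_mul 2)).mul lp)).pow 6
  norm_num at lmain
  norm_num
  refine lmain.congr' ?_
  filter_upwards [hP0, hp0, hC0, hp, hE] with i hP0 hp0 hC0 hp hE
  set K := 3 * C i - (p i ^ 2 + q i ^ 2) / 2 + (-p i + 2 * P i) * p i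
  have e1 : p i ^ 2 + C i = p i ^ 3 / P i := by rw [hp]; field_simp
  have e2 : E i ^ 2 = (-p i + 2 * P i) ^ 2 * K ^ 2 / (4 * C i) := by
    rw [← hE]; field_simp
  have e3 : E i ^ 6 = ((-p i + 2 * P i) ^ 2 * K ^ 2 / (4 * C i)) ^ 3 := by rw [← e2]; ring
  rw [e1, e3]
  field_simp
  ring

/-- The singular behaviour of the generating function of walks in the three-quadrant cone. -/
theorem tendsto_coneGF :
    Tendsto (fun t : ℝ => (1 - 4 * t) ^ (2 / 3 : ℝ) * coneGF t (0, 0)) (𝓝[<] (1 / 4))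
      (𝓝 (32 * √3 / 27)) := by
  have hmem : ∀ᶠ t : ℝ in 𝓝[<] (1 / 4), 0 < t ∧ t < 1 / 4 :=
    Ioo_mem_nhdsLT (by norm_num)
  have hd : ∀ t : ℝ, ∃ p q C A r : ℝ, 0 < t → t < 1 / 4 → 0 < p ∧ p < q ∧ 0 < C ∧
      p ^ 3 = (1 / (2 * t) - 2) * (p ^ 2 + C) ∧ q ^ 3 = (1 / (2 * t) + 2) * (q ^ 2 + C) ∧
      3 * C ^ 2 = (p ^ 2 + q ^ 2) * C + p ^ 2 * q ^ 2 ∧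
      4 * C * ((1 - 4 * t) * (A + 2 / t)) ^ 2 = (-p + 2 * (1 / (2 * t) - 2)) ^ 2 *
        (3 * C - (p ^ 2 + q ^ 2) / 2 + (-p + 2 * (1 / (2 * t) - 2)) * p) ^ 2 ∧
      0 ≤ A ∧ A = 3 * coneGF t (0, 0) + r ∧ 0 ≤ r ∧ r ≤ 2 / √(1 - 4 * t) := by
    intro t
    by_cases h : 0 < t ∧ t < 1 / 4
    · obtain ⟨d⟩ := nonempty_coneData h.1 h.2
      obtain ⟨p, q, C, h1, h2, h3, h4, h5, h6, h7⟩ := d.algebraic_relations h.1 h.2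
      exact ⟨p, q, C, d.massA, d.q, fun _ _ => ⟨h1, h2, h3, h4, h5, h6, h7, d.massA_nonneg,
        d.massA_eq, d.q_nonneg, d.q_le⟩⟩
    · exact ⟨0, 0, 0, 0, 0, fun h1 h2 => absurd ⟨h1, h2⟩ h⟩
  choose p q C A r hd using hd
  have lt : Tendsto (fun t : ℝ => t) (𝓝[<] (1 / 4)) (𝓝 (1 / 4)) := nhdsWithin_le_nhds
  have lε : Tendsto (fun t : ℝ => 1 - 4 * t) (𝓝[<] (1 / 4)) (𝓝 0) := by
    have := (lt.const_mul 4).const_sub 1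
    norm_num at this
    exact this
  have lP : Tendsto (fun t : ℝ => 1 / (2 * t) - 2) (𝓝[<] (1 / 4)) (𝓝 0) := by
    have := (Tendsto.div (tendsto_const_nhds (x := (1 : ℝ))) (lt.const_mul 2)
      (by norm_num)).sub_const 2
    norm_num at this
    simpa using this
  have lE := tendsto_of_algebraic_relations (p := p) (q := q) (C := C)
    (E := fun t => (1 - 4 * t) * (A t + 2 / t)) lP
    (hmem.mono fun t h => by
      rw [sub_pos, lt_div_iff₀ (by linarith [h.1])]; linarith [h.2])
    (hmem.mono fun t h => (hd t h.1 h.2).1)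
    (hmem.mono fun t h => (hd t h.1 h.2).2.1)
    (hmem.mono fun t h => (hd t h.1 h.2).2.2.1)
    (hmem.mono fun t h => (hd t h.1 h.2).2.2.2.1)
    (hmem.mono fun t h => by rw [(hd t h.1 h.2).2.2.2.2.1]; ring)
    (hmem.mono fun t h => (hd t h.1 h.2).2.2.2.2.2.1)
    (hmem.mono fun t h => (hd t h.1 h.2).2.2.2.2.2.2.1)
  have lE2 : Tendsto (fun t : ℝ => ((1 - 4 * t) * (A t + 2 / t)) ^ 6 / (1 - 4 * t) ^ 2)
      (𝓝[<] (1 / 4)) (𝓝 (2 ^ 30 / 3 ^ 9)) := by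
    have h2t : Tendsto (fun t : ℝ => (1 / (2 * t)) ^ 2) (𝓝[<] (1 / 4)) (𝓝 4) := by
      have := (Tendsto.div (tendsto_const_nhds (x := (1 : ℝ))) (lt.const_mul 2)
        (by norm_num)).pow 2
      norm_num at this
      simpa using this
    have h := lE.mul h2t
    rw [show (2 ^ 28 / 3 ^ 9 * 4 : ℝ) = 2 ^ 30 / 3 ^ 9 by norm_num] at h
    refine h.congr' (hmem.mono fun t ht => ?_)
    have h0 : 1 - 4 * t ≠ 0 := by linarith [ht.2]
    have h1 : t ≠ 0 := ht.1.ne'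
    have e : 1 / (2 * t) - 2 = (1 - 4 * t) / (2 * t) := by field_simp; ring
    rw [e]
    field_simp
  have lroot := lE2.rpow_const (p := (6 : ℝ)⁻¹) (Or.inr (by norm_num))
  have eroot : ((2 : ℝ) ^ 30 / 3 ^ 9) ^ (6 : ℝ)⁻¹ = 32 * √3 / 9 := by
    have : (2 : ℝ) ^ 30 / 3 ^ 9 = (32 * √3 / 9) ^ 6 := by
      have h3 : √3 ^ 2 = (3 : ℝ) := Real.sq_sqrt (by norm_num)
      have h6 : √3 ^ 6 = (27 : ℝ) := by
        calc √3 ^ 6 = (√3 ^ 2) ^ 3 := by ring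
          _ = 27 := by rw [h3]; norm_num
      rw [div_pow, mul_pow, h6]
      norm_num
    rw [this]
    exact Real.pow_rpow_inv_natCast (by positivity) (n := 6) (by norm_num)
  rw [eroot] at lroot
  have lrem : Tendsto (fun t : ℝ => 2 / t * (1 - 4 * t) ^ (2 / 3 : ℝ)) (𝓝[<] (1 / 4)) (𝓝 0) := by
    have h1 := lε.rpow_const (p := (2 / 3 : ℝ)) (Or.inr (by norm_num))
    rw [Real.zero_rpow (by norm_num)] at h1
    have h2 := (Tendsto.div (tendsto_const_nhds (x := (2 : ℝ))) lt (by norm_num)).mul h1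
    rw [mul_zero] at h2
    exact h2
  have lq : Tendsto (fun t : ℝ => r t * (1 - 4 * t) ^ (2 / 3 : ℝ)) (𝓝[<] (1 / 4)) (𝓝 0) := by
    have h1 := (lε.rpow_const (p := (1 / 6 : ℝ)) (Or.inr (by norm_num))).const_mul 2
    rw [Real.zero_rpow (by norm_num), mul_zero] at h1
    refine squeeze_zero' (hmem.mono fun t ht => ?_) (hmem.mono fun t ht => ?_) h1
    · exact mul_nonneg (hd t ht.1 ht.2).2.2.2.2.2.2.2.2.2.1
        (Real.rpow_nonneg (by linarith [ht.2]) _)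
    · have hε : 0 < 1 - 4 * t := by linarith [ht.2]
      have hr := (hd t ht.1 ht.2).2.2.2.2.2.2.2.2.2.2
      calc r t * (1 - 4 * t) ^ (2 / 3 : ℝ)
          ≤ 2 / √(1 - 4 * t) * (1 - 4 * t) ^ (2 / 3 : ℝ) := by gcongr
        _ = 2 * (1 - 4 * t) ^ (1 / 6 : ℝ) := by
          rw [Real.sqrt_eq_rpow, show (2 / 3 : ℝ) = 1 / 2 + 1 / 6 by norm_num,
            Real.rpow_add hε]
          field_simp
  have h := ((lroot.sub lrem).sub lq).div_const 3
  rw [show (32 * √3 / 9 - 0 - 0) / 3 = 32 * √3 / 27 by ring] at h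
  refine h.congr' (hmem.mono fun t ht => ?_)
  have hε : 0 < 1 - 4 * t := by linarith [ht.2]
  obtain ⟨-, -, -, -, -, -, -, hA0, hA, -⟩ := hd t ht.1 ht.2
  have hpos : 0 ≤ A t + 2 / t := add_nonneg hA0 (div_nonneg zero_le_two ht.1.le)
  have e1 : (((1 - 4 * t) * (A t + 2 / t)) ^ 6 / (1 - 4 * t) ^ 2) ^ (6 : ℝ)⁻¹ =
      (A t + 2 / t) * (1 - 4 * t) ^ (2 / 3 : ℝ) := by
    have : ((1 - 4 * t) * (A t + 2 / t)) ^ 6 / (1 - 4 * t) ^ 2 =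
        ((A t + 2 / t) * (1 - 4 * t) ^ (2 / 3 : ℝ)) ^ 6 := by
      have e : ((1 - 4 * t) ^ (2 / 3 : ℝ)) ^ 6 = (1 - 4 * t) ^ 4 := by
        rw [← Real.rpow_natCast, ← Real.rpow_mul hε.le, ← Real.rpow_natCast]; norm_num
      rw [mul_pow (A t + 2 / t), e]
      field_simp
    rw [this]
    exact Real.pow_rpow_inv_natCast (mul_nonneg hpos (Real.rpow_nonneg hε.le _)) (n := 6)
      (by norm_num)
  rw [e1, hA]
  ring

theorem tendsto_walkCountAll :
    Tendsto (fun n : ℕ => (n : ℝ) ^ (1 - 2 / 3 : ℝ) *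
      ((walkCountAll squareSteps coneC (0, 0) n : ℝ) / 4 ^ n)) atTop
      (𝓝 (32 * √3 / 27 / Real.Gamma (2 / 3))) := by
  set w : ℕ → ℕ := walkCountAll squareSteps coneC (0, 0) with hw
  set a : ℕ → ℝ := fun n => w n / 4 ^ n with ha
  have ham : Antitone a := antitone_nat_of_succ_le fun n => by
    have h : (w (n + 1) : ℝ) ≤ 4 * w n := by
      exact_mod_cast walkCountAll_succ_le (0, 0) n
    simp only [ha]
    rw [pow_succ, div_le_div_iff₀ (by positivity) (by positivity)]
    nlinarith [pow_pos (four_pos (α := ℝ)) n]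
  have hscale : Tendsto (fun s : ℝ => s / 4) (𝓝[<] 1) (𝓝[<] (1 / 4)) := by
    refine tendsto_nhdsWithin_iff.mpr ⟨?_, ?_⟩
    · exact ((continuous_id.div_const 4).tendsto 1).mono_left nhdsWithin_le_nhds
    · filter_upwards [self_mem_nhdsWithin] with s hs
      have : s < 1 := hs
      exact (by linarith : s / 4 < 1 / 4)
  refine tauberian_antitone (by norm_num) (by norm_num) (fun n => by positivity) ham
    (by positivity) ((tendsto_coneGF.comp hscale).congr fun s => ?_)
  simp only [Function.comp, coneGF]
  rw [mul_div_cancel₀ s four_ne_zero]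
  congr 1
  exact tsum_congr fun n => by rw [hw, div_pow]; ring

end Asymptotics

theorem square_threeQuadrant_total_asymptotics :
    Asymptotics.IsEquivalent Filter.atTop
      (fun n : ℕ => (walkCountAll squareSteps coneC (0, 0) n : ℝ))
      (fun n : ℕ =>
        2^5 * Real.sqrt 3 / (3^3 * Real.Gamma (2/3)) * 4^n / (n : ℝ)^((1 : ℝ)/3)) := by
  have hG : 0 < Real.Gamma (2 / 3) := Real.Gamma_pos_of_pos (by norm_num)
  refine Asymptotics.isEquivalent_of_tendsto_one ?_
  have h := tendsto_walkCountAll.div_const (32 * √3 / 27 / Real.Gamma (2 / 3))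
  rw [div_self (by positivity)] at h
  refine h.congr' ?_
  filter_upwards [Filter.eventually_gt_atTop 0] with n hn
  have hpow : (0 : ℝ) < (n : ℝ) ^ ((1 : ℝ) / 3) := by positivity
  simp only [Pi.div_apply]
  rw [show (1 : ℝ) - 2 / 3 = 1 / 3 by norm_num]
  field_simp
  ring
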